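/- arXiv:2304.09520 — 5 statements merged into one kernel-verified Lean document; each statement's English description precedes it below -/
import Mathlib

section
/- Let (R, m) be a two-dimensional regular local ring, I an integrally closed m-primary ideal with ord(I) >= 2, let (a, b) be a minimal reduction of I, and choose c in I \ (a,b) with mc contained in (a,b). Then the ideal (a, b, c) is minimally generated by three elements. -/
open IsLocalRing

variable {R : Type*} [CommRing R]

/-- `r` lies in the integral closure of the ideal `I`. -/
def MemIntClIdeal (I : Ideal R) (r : R) : Prop :=
  ∃ n : ℕ, 0 < n ∧ ∃ c : ℕ → R, (∀ i, 1 ≤ i → i ≤ n → c i ∈ I ^ i) ∧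
    r ^ n + ∑ i ∈ Finset.Icc 1 n, c i * r ^ (n - i) = 0

/-- An ideal is integrally closed if it contains its integral closure. -/
def IsIntClIdeal (I : Ideal R) : Prop := ∀ r, MemIntClIdeal I r → r ∈ I

/-- Determinant of the 2×2 matrix with columns `v`, `w`. -/
def det2 (v w : Fin 2 → R) : R := v 0 * w 1 - v 1 * w 0

/-- The ideal of maximal minors `I(M)` of a rank-two module `M ⊆ R²`. -/
def minorsIdeal (M : Submodule R (Fin 2 → R)) : Ideal R :=
  Ideal.span {r | ∃ v ∈ M, ∃ w ∈ M, det2 v w = r}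

/-- The ideal `I₁(M)` generated by the entries of a matrix whose columns generate `M`. -/
def entriesIdeal (M : Submodule R (Fin 2 → R)) : Ideal R :=
  Ideal.span {r | ∃ v ∈ M, r = v 0 ∨ r = v 1}

/-- `v` is integral over the module `M` (Rees' determinantal criterion). -/
def MemIntClMod (M : Submodule R (Fin 2 → R)) (v : Fin 2 → R) : Prop :=
  ∀ w ∈ M, MemIntClIdeal (minorsIdeal M) (det2 v w)

/-- `M ⊆ R²` is integrally closed. -/
def IsIntClMod (M : Submodule R (Fin 2 → R)) : Prop :=
  ∀ v, MemIntClMod M v → v ∈ M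

/-- `M` is indecomposable as a direct sum. -/
def IsIndecomposable (M : Submodule R (Fin 2 → R)) : Prop :=
  ∀ N P : Submodule R (Fin 2 → R), N ⊔ P = M → N ⊓ P = ⊥ → N = ⊥ ∨ P = ⊥

/-- `M` has a nonzero free direct summand. -/
def HasFreeSummand (M : Submodule R (Fin 2 → R)) : Prop :=
  ∃ N P : Submodule R (Fin 2 → R), N ⊔ P = M ∧ N ⊓ P = ⊥ ∧ N ≠ ⊥ ∧ Module.Free R N

/-- An ideal is simple if it is not the product of two proper ideals. -/
def IsSimpleIdeal (I : Ideal R) : Prop :=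
  I ≠ ⊤ ∧ ∀ J K : Ideal R, I = J * K → J = ⊤ ∨ K = ⊤

/-- In a Noetherian local ring of dimension two, no principal ideal is primary to the maximal
ideal. -/
theorem not_maximalIdeal_le_radical_span_singleton [IsNoetherianRing R] [IsLocalRing R]
    (hdim : ringKrullDim R = 2) {s : R} (hs : s ∈ maximalIdeal R) :
    ¬ maximalIdeal R ≤ (Ideal.span {s}).radical := by
  intro h
  have hmin : maximalIdeal R ∈ (Ideal.span {s}).minimalPrimes :=
    ⟨⟨inferInstance, (Ideal.span_singleton_le_iff_mem _).2 hs⟩,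
      fun q hq _ => h.trans (hq.1.radical_le_iff.2 hq.2)⟩
  have hheight := Ideal.height_le_one_of_isPrincipal_of_mem_minimalPrimes _ _ hmin
  have htwo := IsLocalRing.maximalIdeal_height_eq_ringKrullDim (R := R)
  rw [hdim] at htwo
  have htwo' : (maximalIdeal R).height = 2 := WithBot.coe_injective htwo
  rw [htwo'] at hheight
  exact absurd hheight (by decide)

/-- If `x` and `y` generate the maximal ideal of a two-dimensional local ring, then `x` is a
nonzerodivisor modulo `y`. -/
theorem mem_span_singleton_of_mul_mem_of_maximalIdeal_eq [IsNoetherianRing R] [IsLocalRing R]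
    (hdim : ringKrullDim R = 2) {x y : R} (hxy : maximalIdeal R = Ideal.span {x, y})
    {r : R} (hr : x * r ∈ Ideal.span {y}) : r ∈ Ideal.span {y} := by
  have hx : x ∈ maximalIdeal R := hxy ▸ Ideal.subset_span (by simp)
  have hy : y ∈ maximalIdeal R := hxy ▸ Ideal.subset_span (by simp)
  let K : Ideal R :=
    { carrier := {r | ∃ n : ℕ, x ^ n * r ∈ Ideal.span {y}}
      zero_mem' := ⟨0, by simp⟩
      add_mem' := by
        rintro p q ⟨n, hn⟩ ⟨k, hk⟩
        refine ⟨n + k, ?_⟩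
        have h := add_mem (Ideal.mul_mem_left _ (x ^ k) hn) (Ideal.mul_mem_left _ (x ^ n) hk)
        convert h using 1
        ring
      smul_mem' := by
        rintro t p ⟨n, hn⟩
        refine ⟨n, ?_⟩
        have h := Ideal.mul_mem_left _ t hn
        convert h using 1
        simp only [smul_eq_mul]
        ring }
  have hKm : K ≤ maximalIdeal R := by
    rintro p ⟨n, hn⟩
    by_contra hp
    have hunit : IsUnit p := by simpa using hp
    have hxn : x ^ n ∈ Ideal.span {y} := (Ideal.mul_unit_mem_iff_mem _ hunit).1 hn
    refine not_maximalIdeal_le_radical_span_singleton hdim hy ?_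
    rw [hxy, Ideal.span_le]
    rintro t (rfl | rfl)
    · exact ⟨n, hxn⟩
    · exact Ideal.le_radical (Ideal.mem_span_singleton_self _)
  have hK : K ≤ Ideal.span {y} ⊔ maximalIdeal R • K := by
    intro p hp
    obtain ⟨s, t, hst⟩ := Ideal.mem_span_pair.1 (hxy ▸ hKm hp)
    obtain ⟨n, hn⟩ := hp
    have hs : s ∈ K := by
      refine ⟨n + 1, ?_⟩
      have h := sub_mem hn (Ideal.mul_mem_left _ (x ^ n * t) (Ideal.mem_span_singleton_self y))
      convert h using 1
      rw [← hst]
      ring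
    rw [← hst, add_comm]
    refine Submodule.add_mem_sup (Ideal.mul_mem_left _ _ (Ideal.mem_span_singleton_self y)) ?_
    rw [mul_comm]
    exact Submodule.smul_mem_smul hx hs
  exact Submodule.le_of_le_smul_of_le_jacobson_bot (IsNoetherian.noetherian K)
    (IsLocalRing.maximalIdeal_le_jacobson ⊥) hK ⟨1, by simpa using hr⟩

/-- In a two-dimensional regular local domain, a system of parameters is a regular sequence. -/
theorem mem_span_singleton_of_mul_mem_of_maximalIdeal_pow_le [IsNoetherianRing R] [IsLocalRing R]
    [IsDomain R] (hdim : ringKrullDim R = 2) (hreg : ∃ x y : R, maximalIdeal R = Ideal.span {x, y})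
    {c d : R} (hd : d ≠ 0) {N : ℕ} (hN : maximalIdeal R ^ N ≤ Ideal.span {c, d})
    {r : R} (hr : r * c ∈ Ideal.span {d}) : r ∈ Ideal.span {d} := by
  obtain ⟨x, y, hxy⟩ := hreg
  have hx : x ∈ maximalIdeal R := hxy ▸ Ideal.subset_span (by simp)
  have hy : y ∈ maximalIdeal R := hxy ▸ Ideal.subset_span (by simp)
  have socle : ∀ z, (∀ t ∈ maximalIdeal R, t * z ∈ Ideal.span {d}) → z ∈ Ideal.span {d} := by
    intro z hz
    obtain ⟨p, hp⟩ := Ideal.mem_span_singleton'.1 (hz x hx)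
    obtain ⟨q, hq⟩ := Ideal.mem_span_singleton'.1 (hz y hy)
    have hpq : x * q = p * y := mul_right_cancel₀ hd (by linear_combination x * hq - y * hp)
    have hmem : q ∈ Ideal.span {y} := mem_span_singleton_of_mul_mem_of_maximalIdeal_eq hdim hxy
      (Ideal.mem_span_singleton'.2 ⟨p, hpq.symm⟩)
    obtain ⟨w, rfl⟩ := Ideal.mem_span_singleton'.1 hmem
    have hy0 : y ≠ 0 := by
      rintro rfl
      refine not_maximalIdeal_le_radical_span_singleton hdim hx ?_
      refine le_trans ?_ Ideal.le_radical
      rw [hxy, Ideal.span_le]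
      rintro t (rfl | rfl)
      · exact Ideal.mem_span_singleton_self _
      · exact zero_mem _
    exact Ideal.mem_span_singleton'.2
      ⟨w, mul_left_cancel₀ hy0 (by linear_combination hq)⟩
  have descend : ∀ k : ℕ, (∀ t ∈ maximalIdeal R ^ k, t * r ∈ Ideal.span {d}) →
      r ∈ Ideal.span {d} := by
    intro k
    induction k with
    | zero => intro h; simpa using h 1 (by simp)
    | succ k ih =>
      intro h
      refine ih fun w hw => socle _ fun t ht => ?_
      rw [← mul_assoc]
      exact h _ (pow_succ' (maximalIdeal R) k ▸ Ideal.mul_mem_mul ht hw)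
  refine descend N fun t ht => ?_
  obtain ⟨p, q, rfl⟩ := Ideal.mem_span_pair.1 (hN ht)
  have h := add_mem (Ideal.mul_mem_left _ p hr)
    (Ideal.mul_mem_left _ (q * r) (Ideal.mem_span_singleton_self d))
  convert h using 1
  ring

/-- Let `(a, b)` be primary to the maximal ideal `m` of a two-dimensional regular local domain,
with `a ∈ m ^ 2`. If `c` generates the socle modulo `(a, b)`, then `b ∉ (c, a)`. -/
theorem notMem_span_pair_of_socle [IsNoetherianRing R] [IsLocalRing R]
    [IsDomain R] (hdim : ringKrullDim R = 2) (hreg : ∃ x y : R, maximalIdeal R = Ideal.span {x, y})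
    {a b c : R} (ha : a ∈ maximalIdeal R ^ 2) (hc : c ∈ maximalIdeal R)
    {N : ℕ} (hN : maximalIdeal R ^ N ≤ Ideal.span {a, b})
    (hcab : c ∉ Ideal.span {a, b}) (hmc : ∀ t ∈ maximalIdeal R, t * c ∈ Ideal.span {a, b}) :
    b ∉ Ideal.span {c, a} := by
  intro hb
  have hN' : maximalIdeal R ^ N ≤ Ideal.span {c, a} := by
    refine hN.trans (Ideal.span_le.2 ?_)
    rintro t (rfl | rfl)
    · exact Ideal.subset_span (by simp)
    · exact hb
  have ha0 : a ≠ 0 := by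
    rintro rfl
    refine not_maximalIdeal_le_radical_span_singleton hdim hc fun t ht => ⟨N, ?_⟩
    have h := hN' (Ideal.pow_mem_pow ht N)
    rwa [Set.pair_comm, Ideal.span_insert_zero] at h
  obtain ⟨s, p, hsp⟩ := Ideal.mem_span_pair.1 hb
  have hs : s ∈ maximalIdeal R := by
    by_contra hs
    have hunit : IsUnit s := by simpa using hs
    refine hcab ((Ideal.unit_mul_mem_iff_mem _ hunit).1 (Ideal.mem_span_pair.2 ⟨-p, 1, ?_⟩))
    linear_combination -hsp
  refine not_maximalIdeal_le_radical_span_singleton hdim hs (le_trans ?_ Ideal.le_radical)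
  refine Submodule.le_of_le_smul_of_le_jacobson_bot (I := maximalIdeal R)
    (IsNoetherian.noetherian _) (IsLocalRing.maximalIdeal_le_jacobson ⊥) fun t ht => ?_
  obtain ⟨e, f, hef⟩ := Ideal.mem_span_pair.1 (hmc t ht)
  have h : t - f * s ∈ Ideal.span {a} := by
    refine mem_span_singleton_of_mul_mem_of_maximalIdeal_pow_le hdim hreg ha0 hN'
      (Ideal.mem_span_singleton'.2 ⟨e + f * p, ?_⟩)
    linear_combination hef + f * hsp
  have h2 : t - f * s ∈ maximalIdeal R • maximalIdeal R := by
    rw [smul_eq_mul, ← pow_two]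
    exact (Ideal.span_singleton_le_iff_mem _).2 ha h
  have h3 := Submodule.add_mem_sup
    (Ideal.mul_mem_left _ f (Ideal.mem_span_singleton_self s)) h2
  rwa [add_sub_cancel] at h3

theorem stmt3 [IsNoetherianRing R] [IsLocalRing R] [IsDomain R]
    [Infinite (ResidueField R)]
    (hdim : ringKrullDim R = 2)
    (hreg : ∃ x y : R, maximalIdeal R = Ideal.span {x, y})
    (I : Ideal R) (hicl : IsIntClIdeal I) (hprim : I.radical = maximalIdeal R)
    (hord : I ≤ maximalIdeal R ^ 2)
    (a b : R) (hab : Ideal.span {a, b} ≤ I)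
    (hred : ∃ n : ℕ, I ^ (n + 1) = Ideal.span {a, b} * I ^ n)
    (c : R) (hcI : c ∈ I) (hcab : c ∉ Ideal.span {a, b})
    (hmc : maximalIdeal R * Ideal.span {c} ≤ Ideal.span {a, b}) :
    ¬ ∃ u v : R, Ideal.span {u, v} = Ideal.span {a, b, c} := by
  have hmc' : ∀ t ∈ maximalIdeal R, t * c ∈ Ideal.span {a, b} := fun t ht =>
    hmc (Ideal.mul_mem_mul ht (Ideal.mem_span_singleton_self c))
  have hc : c ∈ maximalIdeal R := Ideal.pow_le_self two_ne_zero (hord hcI)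
  obtain ⟨N, hN⟩ : ∃ N : ℕ, maximalIdeal R ^ N ≤ Ideal.span {a, b} := by
    obtain ⟨k, hk⟩ := Ideal.exists_radical_pow_le_of_fg I (IsNoetherian.noetherian _)
    obtain ⟨n, hn⟩ := hred
    refine ⟨k * (n + 1), ?_⟩
    rw [pow_mul, ← hprim]
    exact (Ideal.pow_right_mono hk _).trans (hn.trans_le Ideal.mul_le_left)
  have hb : b ∉ Ideal.span {c, a} := notMem_span_pair_of_socle hdim hreg
    (hord (hab (Ideal.subset_span (by simp)))) hc hN hcab hmc'
  have ha : a ∉ Ideal.span {c, b} := by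
    rw [Set.pair_comm a b] at hab hN hcab hmc'
    exact notMem_span_pair_of_socle hdim hreg
      (hord (hab (Ideal.subset_span (by simp)))) hc hN hcab hmc'
  have key : ∀ v : R, Ideal.span {c, v} ≠ Ideal.span {a, b, c} := by
    intro v hv
    have hav : a ∈ Ideal.span {c, v} := hv ▸ Ideal.subset_span (by simp)
    have hbv : b ∈ Ideal.span {c, v} := hv ▸ Ideal.subset_span (by simp)
    have hvm : v ∈ Ideal.span {a, b, c} := hv ▸ Ideal.subset_span (by simp)
    obtain ⟨p, q, hpq⟩ := Ideal.mem_span_pair.1 hav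
    obtain ⟨s, t, hst⟩ := Ideal.mem_span_pair.1 hbv
    obtain ⟨e, f, g, hefg⟩ := Submodule.mem_span_triple.1 hvm
    simp only [smul_eq_mul] at hefg
    have coeff_mem : ∀ {a b p q s t : R}, p * c + q * v = a → s * c + t * v = b →
        b ∉ Ideal.span {c, a} → q ∈ maximalIdeal R := by
      intro a b p q s t hpq hst hb
      by_contra hq
      have hunit : IsUnit q := by simpa using hq
      have hva : v ∈ Ideal.span {c, a} := (Ideal.unit_mul_mem_iff_mem _ hunit).1
        (Ideal.mem_span_pair.2 ⟨-p, 1, by linear_combination -hpq⟩)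
      exact hb (hst ▸ add_mem (Ideal.mul_mem_left _ _ (Ideal.subset_span (by simp)))
        (Ideal.mul_mem_left _ _ hva))
    have hq := coeff_mem hpq hst hb
    have ht := coeff_mem hst hpq ha
    have hunit : IsUnit (1 - (e * q + f * t)) := by
      have hm : e * q + f * t ∈ maximalIdeal R :=
        add_mem (Ideal.mul_mem_left _ _ hq) (Ideal.mul_mem_left _ _ ht)
      rcases IsLocalRing.isUnit_or_isUnit_one_sub_self (e * q + f * t) with h | h
      · exact absurd h (by simpa using hm)
      · exact h
    have hvc : v ∈ Ideal.span {c} := (Ideal.unit_mul_mem_iff_mem _ hunit).1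
      (Ideal.mem_span_singleton'.2 ⟨e * p + f * s + g, by
        linear_combination hefg + e * hpq + f * hst⟩)
    exact hb (Ideal.span_mono (by simp) (hst ▸ add_mem
      (Ideal.mul_mem_left _ _ (Ideal.mem_span_singleton_self c)) (Ideal.mul_mem_left _ _ hvc)))
  rintro ⟨u, v, huv⟩
  have hcu : c ∈ Ideal.span {u, v} := huv ▸ Ideal.subset_span (by simp)
  have coeff_mem : ∀ {u v p q : R}, Ideal.span {u, v} = Ideal.span {a, b, c} →
      p * u + q * v = c → p ∈ maximalIdeal R := by
    intro u v p q huv hpq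
    by_contra hp
    have hunit : IsUnit p := by simpa using hp
    have hu : u ∈ Ideal.span {c, v} := (Ideal.unit_mul_mem_iff_mem _ hunit).1
      (Ideal.mem_span_pair.2 ⟨1, -q, by linear_combination -hpq⟩)
    refine key v (le_antisymm ?_ ?_)
    · rw [Ideal.span_le]
      rintro t (rfl | rfl)
      · exact Ideal.subset_span (by simp)
      · exact huv ▸ Ideal.subset_span (by simp)
    · rw [← huv, Ideal.span_le]
      rintro t (rfl | rfl)
      · exact hu
      · exact Ideal.subset_span (by simp)
  obtain ⟨p, q, hpq⟩ := Ideal.mem_span_pair.1 hcu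
  have hp := coeff_mem huv hpq
  have hq := coeff_mem ((congrArg _ (Set.pair_comm v u)).trans huv) ((add_comm _ _).trans hpq)
  have smul_mem : ∀ r ∈ maximalIdeal R, ∀ t ∈ Ideal.span {a, b, c},
      r * t ∈ Ideal.span {a, b} := by
    intro r hr t ht
    obtain ⟨e, f, g, rfl⟩ := Submodule.mem_span_triple.1 ht
    have h := add_mem (Ideal.mem_span_pair.2 ⟨r * e, r * f, rfl⟩)
      (Ideal.mul_mem_left _ g (hmc' r hr))
    convert h using 1
    simp only [smul_eq_mul]
    ring
  exact hcab (hpq ▸ add_mem (smul_mem p hp u (huv ▸ Ideal.subset_span (by simp)))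
    (smul_mem q hq v (huv ▸ Ideal.subset_span (by simp))))
end

section
/- Let (R, m) be a two-dimensional regular local ring with infinite residue field and I an integrally closed m-primary ideal of order 2 that is either simple, or a product I = JK of two simple integrally closed m-primary ideals with J + K ≠ m. Then I is the ideal of maximal minors of an indecomposable integrally closed R-module of rank two. -/
open IsLocalRing

variable {R : Type*} [CommRing R]

section RegularParameters

variable [IsLocalRing R] {x y : R}

lemma not_maximalIdeal_pow_le_span_singleton [IsNoetherianRing R] (hdim : ringKrullDim R = 2)
    (hx : x ∈ maximalIdeal R) (n : ℕ) : ¬ maximalIdeal R ^ n ≤ Ideal.span {x} := by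
  intro h
  have hmin : maximalIdeal R ∈ (Ideal.span {x}).minimalPrimes := by
    refine ⟨⟨inferInstance, by simpa [Ideal.span_le] using hx⟩, fun p hp _ => ?_⟩
    have := hp.1
    exact Ideal.IsPrime.le_of_pow_le (h.trans hp.2)
  have h1 := Ideal.height_le_one_of_isPrincipal_of_mem_minimalPrimes _ _ hmin
  have h2 := IsLocalRing.maximalIdeal_height_eq_ringKrullDim (R := R)
  rw [hdim] at h2
  have h3 : (maximalIdeal R).height = 2 := WithBot.coe_injective h2
  rw [h3] at h1
  exact absurd h1 (by decide)

lemma maximalIdeal_eq_span_swap (hm : maximalIdeal R = Ideal.span {x, y}) :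
    maximalIdeal R = Ideal.span {y, x} := by
  rw [hm, Set.pair_comm]

lemma mem_maximalIdeal_left (hm : maximalIdeal R = Ideal.span {x, y}) : x ∈ maximalIdeal R :=
  hm ▸ Ideal.subset_span (by simp)

lemma mem_maximalIdeal_right (hm : maximalIdeal R = Ideal.span {x, y}) : y ∈ maximalIdeal R :=
  hm ▸ Ideal.subset_span (by simp)

lemma exists_of_mem_maximalIdeal (hm : maximalIdeal R = Ideal.span {x, y}) {r : R}
    (hr : r ∈ maximalIdeal R) : ∃ a b, r = a * x + b * y := by
  rw [hm, Ideal.mem_span_pair] at hr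
  obtain ⟨a, b, h⟩ := hr
  exact ⟨a, b, h.symm⟩

lemma exists_of_mem_maximalIdeal_sq (hm : maximalIdeal R = Ideal.span {x, y}) {r : R}
    (hr : r ∈ maximalIdeal R ^ 2) : ∃ a b c, r = a * x ^ 2 + b * (x * y) + c * y ^ 2 := by
  rw [pow_two] at hr
  induction hr using Submodule.mul_induction_on' with
  | mem_mul_mem s hs t ht =>
    obtain ⟨a, b, rfl⟩ := exists_of_mem_maximalIdeal hm hs
    obtain ⟨c, d, rfl⟩ := exists_of_mem_maximalIdeal hm ht
    exact ⟨a * c, a * d + b * c, b * d, by ring⟩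
  | add s _ t _ hs ht =>
    obtain ⟨a, b, c, rfl⟩ := hs
    obtain ⟨a', b', c', rfl⟩ := ht
    exact ⟨a + a', b + b', c + c', by ring⟩

lemma exists_of_mem_maximalIdeal_cube (hm : maximalIdeal R = Ideal.span {x, y}) {r : R}
    (hr : r ∈ maximalIdeal R ^ 3) : ∃ a ∈ maximalIdeal R, ∃ b ∈ maximalIdeal R,
      ∃ c ∈ maximalIdeal R, r = a * x ^ 2 + b * (x * y) + c * y ^ 2 := by
  rw [pow_succ] at hr
  induction hr using Submodule.mul_induction_on' with
  | mem_mul_mem s hs t ht =>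
    obtain ⟨a, b, c, rfl⟩ := exists_of_mem_maximalIdeal_sq hm hs
    exact ⟨a * t, Ideal.mul_mem_left _ _ ht, b * t, Ideal.mul_mem_left _ _ ht,
      c * t, Ideal.mul_mem_left _ _ ht, by ring⟩
  | add s _ t _ hs ht =>
    obtain ⟨a, ha, b, hb, c, hc, rfl⟩ := hs
    obtain ⟨a', ha', b', hb', c', hc', rfl⟩ := ht
    exact ⟨a + a', add_mem ha ha', b + b', add_mem hb hb', c + c', add_mem hc hc', by ring⟩

lemma mem_maximalIdeal_of_mul_mem {a u : R} (h : u * a ∈ maximalIdeal R)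
    (hu : u ∉ maximalIdeal R) : a ∈ maximalIdeal R :=
  ((Ideal.IsPrime.mem_or_mem inferInstance h).resolve_left hu)

variable [IsNoetherianRing R]

lemma right_notMem_span_left (hdim : ringKrullDim R = 2)
    (hm : maximalIdeal R = Ideal.span {x, y}) (n : ℕ) : y ^ n ∉ Ideal.span {x} := by
  intro h
  have hp : maximalIdeal R ≤ (Ideal.span {x}).radical := by
    rw [hm, Ideal.span_le, Set.insert_subset_iff, Set.singleton_subset_iff]
    exact ⟨Ideal.le_radical (Ideal.mem_span_singleton_self x), n, h⟩
  obtain ⟨k, hk⟩ := Ideal.exists_pow_le_of_le_radical_of_fg hp (IsNoetherian.noetherian _)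
  exact not_maximalIdeal_pow_le_span_singleton hdim (mem_maximalIdeal_left hm) k hk

lemma right_coeff_mem_of_linear_relation (hdim : ringKrullDim R = 2)
    (hm : maximalIdeal R = Ideal.span {x, y}) {n : ℕ} {s t : R} (h : s * x + t * y ^ n = 0) :
    t ∈ maximalIdeal R := by
  by_contra ht
  obtain ⟨u, rfl⟩ := of_not_not (mt (mem_maximalIdeal t).2 ht)
  refine right_notMem_span_left hdim hm n (Ideal.mem_span_singleton'.2 ⟨-↑u⁻¹ * s, ?_⟩)
  have hu : (↑u⁻¹ : R) * u = 1 := u.inv_mul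
  linear_combination (-↑u⁻¹ : R) * h + y ^ n * hu

lemma coeff_mem_of_linear_mem_sq (hdim : ringKrullDim R = 2)
    (hm : maximalIdeal R = Ideal.span {x, y}) {s t : R}
    (h : s * x + t * y ∈ maximalIdeal R ^ 2) : s ∈ maximalIdeal R ∧ t ∈ maximalIdeal R := by
  have hx := mem_maximalIdeal_left hm
  have hy := mem_maximalIdeal_right hm
  obtain ⟨a, b, c, e⟩ := exists_of_mem_maximalIdeal_sq hm h
  constructor
  · have := right_coeff_mem_of_linear_relation hdim (maximalIdeal_eq_span_swap hm) (n := 1)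
      (s := t - c * y - b * x) (t := s - a * x) (by linear_combination e)
    simpa using add_mem this (Ideal.mul_mem_left _ a hx)
  · have := right_coeff_mem_of_linear_relation hdim hm (n := 1)
      (s := s - a * x - b * y) (t := t - c * y) (by linear_combination e)
    simpa using add_mem this (Ideal.mul_mem_left _ c hy)

lemma coeff_mem_of_quadratic_relation (hdim : ringKrullDim R = 2)
    (hm : maximalIdeal R = Ideal.span {x, y}) {a b c : R}
    (h : a * x ^ 2 + b * (x * y) + c * y ^ 2 = 0) :
    a ∈ maximalIdeal R ∧ b ∈ maximalIdeal R ∧ c ∈ maximalIdeal R := by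
  have hc : c ∈ maximalIdeal R := right_coeff_mem_of_linear_relation hdim hm (n := 2)
    (s := a * x + b * y) (by linear_combination h)
  have ha : a ∈ maximalIdeal R :=
    right_coeff_mem_of_linear_relation hdim (maximalIdeal_eq_span_swap hm) (n := 2)
      (s := c * y + b * x) (by linear_combination h)
  refine ⟨ha, ?_, hc⟩
  have hm' : maximalIdeal R = Ideal.span {y - x, x} := by
    rw [hm]
    apply le_antisymm <;>
      rw [Ideal.span_le, Set.insert_subset_iff, Set.singleton_subset_iff] <;>
      simp only [SetLike.mem_coe, Ideal.mem_span_pair]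
    · exact ⟨⟨0, 1, by ring⟩, ⟨1, 1, by ring⟩⟩
    · exact ⟨⟨-1, 1, by ring⟩, ⟨1, 0, by ring⟩⟩
  have := right_coeff_mem_of_linear_relation hdim hm' (n := 2)
    (s := b * x + c * (y - x) + 2 * c * x) (t := a + b + c) (by linear_combination h)
  have e : b = (a + b + c) - a - c := by ring
  rw [e]
  exact sub_mem (sub_mem this ha) hc

lemma coeff_mem_of_quadratic_mem_cube (hdim : ringKrullDim R = 2)
    (hm : maximalIdeal R = Ideal.span {x, y}) {a b c : R}
    (h : a * x ^ 2 + b * (x * y) + c * y ^ 2 ∈ maximalIdeal R ^ 3) :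
    a ∈ maximalIdeal R ∧ b ∈ maximalIdeal R ∧ c ∈ maximalIdeal R := by
  obtain ⟨a', ha, b', hb, c', hc, e⟩ := exists_of_mem_maximalIdeal_cube hm h
  obtain ⟨h1, h2, h3⟩ := coeff_mem_of_quadratic_relation hdim hm
    (a := a - a') (b := b - b') (c := c - c') (by linear_combination e)
  exact ⟨by simpa using add_mem h1 ha, by simpa using add_mem h2 hb,
    by simpa using add_mem h3 hc⟩

lemma exists_sub_mul_pow_mem_span (hm : maximalIdeal R = Ideal.span {x, y}) {r : R}
    (hr : r ∉ Ideal.span {x}) : ∃ n : ℕ, ∃ u ∉ maximalIdeal R, r - u * y ^ n ∈ Ideal.span {x} := by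
  by_contra! hcon
  have key : ∀ n : ℕ, ∃ t, r - t * y ^ n ∈ Ideal.span {x} := by
    intro n
    induction n with
    | zero => exact ⟨r, by simp⟩
    | succ n ih =>
      obtain ⟨t, ht⟩ := ih
      obtain ⟨a, b, rfl⟩ : ∃ a b, t = a * x + b * y :=
        exists_of_mem_maximalIdeal hm (by by_contra h; exact hcon n t h ht)
      refine ⟨b, ?_⟩
      have := add_mem ht (Ideal.mul_mem_left _ (a * y ^ n) (Ideal.mem_span_singleton_self x))
      convert this using 1
      ring
  have hxm : Ideal.span {x} ≤ maximalIdeal R := by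
    simpa [Ideal.span_le] using mem_maximalIdeal_left hm
  have hne : Ideal.span {x} ≠ ⊤ := fun h => (maximalIdeal.isMaximal R).ne_top (top_le_iff.1 (h ▸ hxm))
  have : Nontrivial (R ⧸ Ideal.span {x}) := Ideal.Quotient.nontrivial_iff.2 hne
  have hloc : IsLocalRing (R ⧸ Ideal.span {x}) :=
    IsLocalRing.of_surjective' (Ideal.Quotient.mk _) Ideal.Quotient.mk_surjective
  have hJ : Ideal.span {Ideal.Quotient.mk (Ideal.span {x}) y} ≠ ⊤ := by
    intro h
    rw [Ideal.span_singleton_eq_top] at h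
    obtain ⟨z, hz⟩ := h.exists_right_inv
    obtain ⟨z, rfl⟩ := Ideal.Quotient.mk_surjective z
    rw [← map_mul, ← map_one (Ideal.Quotient.mk _), Ideal.Quotient.eq] at hz
    have h1 := sub_mem (Ideal.mul_mem_right z _ (mem_maximalIdeal_right hm)) (hxm hz)
    rw [sub_sub_cancel] at h1
    exact (maximalIdeal.isMaximal R).ne_top ((Ideal.eq_top_iff_one _).2 h1)
  have hbot := Ideal.iInf_pow_eq_bot_of_isLocalRing _ hJ
  refine hr (Ideal.Quotient.eq_zero_iff_mem.1 ?_)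
  rw [← Ideal.mem_bot, ← hbot, Ideal.mem_iInf]
  intro n
  obtain ⟨t, ht⟩ := key n
  rw [Ideal.span_singleton_pow, Ideal.mem_span_singleton']
  refine ⟨Ideal.Quotient.mk _ t, ?_⟩
  rw [← map_pow, ← map_mul]
  exact (Ideal.Quotient.eq.2 ht).symm

lemma prime_regularParameter [IsDomain R] (hdim : ringKrullDim R = 2)
    (hm : maximalIdeal R = Ideal.span {x, y}) : Prime x := by
  have h0 : x ≠ 0 := by
    rintro rfl
    have := coeff_mem_of_linear_mem_sq hdim hm (s := 1) (t := 0) (by simp)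
    exact (maximalIdeal.isMaximal R).ne_top ((Ideal.eq_top_iff_one _).2 this.1)
  refine ⟨h0, (mem_maximalIdeal x).1 (mem_maximalIdeal_left hm), fun a b hab => ?_⟩
  by_contra! hcon
  rw [← Ideal.mem_span_singleton, ← Ideal.mem_span_singleton] at hcon
  rw [← Ideal.mem_span_singleton] at hab
  obtain ⟨n, u, hu, hn⟩ := exists_sub_mul_pow_mem_span hm hcon.1
  obtain ⟨k, v, hv, hk⟩ := exists_sub_mul_pow_mem_span hm hcon.2
  have h1 : (u * v) * y ^ (n + k) ∈ Ideal.span {x} := by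
    have := sub_mem hab (add_mem (Ideal.mul_mem_right b _ hn)
      (Ideal.mul_mem_left _ (u * y ^ n) hk))
    convert this using 1
    ring
  obtain ⟨s, hs⟩ := Ideal.mem_span_singleton'.1 h1
  have h2 := right_coeff_mem_of_linear_relation hdim hm (n := n + k) (s := -s) (t := u * v)
    (by linear_combination -hs)
  exact hv (mem_maximalIdeal_of_mul_mem h2 hu)

end RegularParameters

section IntegralClosure

variable {I : Ideal R}

lemma memIntClIdeal_of_quadratic {r b c : R} (hb : b ∈ I) (hc : c ∈ I ^ 2)
    (h : r ^ 2 + b * r + c = 0) : MemIntClIdeal I r := by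
  refine ⟨2, two_pos, fun i => if i = 1 then b else c, fun i h1 h2 => ?_, ?_⟩
  · obtain rfl | rfl : i = 1 ∨ i = 2 := by omega
    · simpa using hb
    · simpa using hc
  · rw [show Finset.Icc 1 2 = {1, 2} from rfl, Finset.sum_pair (by decide)]
    simpa [add_assoc] using h

lemma memIntClIdeal_of_forall_mul_mem_sq [IsDomain R] [IsNoetherianRing R] (hI : I ≠ ⊥) {d : R}
    (h : ∀ g ∈ I, d * g ∈ I ^ 2) : MemIntClIdeal I d := by
  obtain ⟨p, hp, -, hcoeff, heval⟩ :=
    LinearMap.exists_monic_and_natDegree_eq_and_coeff_mem_pow_and_aeval_eq_zero R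
      (algebraMap R (Module.End R I) d) I (by
        rintro _ ⟨g, rfl⟩
        rw [Submodule.mem_smul_top_iff, smul_eq_mul, ← pow_two]
        exact h g g.2)
  rw [Polynomial.aeval_algebraMap_apply_eq_algebraMap_eval] at heval
  obtain ⟨g, hg, hg0⟩ := Submodule.exists_mem_ne_zero_of_ne_bot hI
  have hroot : p.eval d = 0 := by
    have := congrArg Subtype.val (LinearMap.congr_fun heval ⟨g, hg⟩)
    exact (mul_eq_zero.1 this).resolve_right hg0
  have hpos : 0 < p.natDegree := by
    rw [Nat.pos_iff_ne_zero]
    intro h0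
    rw [hp.natDegree_eq_zero.1 h0, Polynomial.eval_one] at hroot
    exact one_ne_zero hroot
  refine ⟨p.natDegree, hpos, fun i => p.coeff (p.natDegree - i), fun i _ hi => ?_, ?_⟩
  · simpa [Nat.sub_sub_self hi] using hcoeff (p.natDegree - i)
  · rw [Polynomial.eval_eq_sum_range, Finset.sum_range_succ, hp.coeff_natDegree, one_mul,
      add_comm] at hroot
    rw [← hroot]
    congr 1
    refine Finset.sum_nbij' (fun i => p.natDegree - i) (fun i => p.natDegree - i) ?_ ?_ ?_ ?_ ?_
    all_goals intro i hi; simp only [Finset.mem_Icc, Finset.mem_range] at *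
    all_goals omega

end IntegralClosure

section Decomposition

lemma det2_smul_eq (v w u : Fin 2 → R) : det2 v w • u = det2 u w • v + det2 v u • w := by
  ext i
  fin_cases i <;> simp [det2] <;> ring

lemma det2_eq_zero_of_disjoint [IsDomain R] {N P : Submodule R (Fin 2 → R)} (h : N ⊓ P = ⊥)
    (hP : P ≠ ⊥) {v w : Fin 2 → R} (hv : v ∈ N) (hw : w ∈ N) : det2 v w = 0 := by
  obtain ⟨p, hp, hp0⟩ := Submodule.exists_mem_ne_zero_of_ne_bot hP
  have hN : det2 v w • p ∈ N := by
    rw [det2_smul_eq]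
    exact add_mem (N.smul_mem _ hv) (N.smul_mem _ hw)
  have : det2 v w • p ∈ N ⊓ P := ⟨hN, P.smul_mem _ hp⟩
  rw [h, Submodule.mem_bot] at this
  exact (smul_eq_zero.1 this).resolve_right hp0

lemma exists_smul_decomposition {N P : Submodule R (Fin 2 → R)}
    (h : N ⊓ P = ⊥) {s t : R} (hst : ∀ a b, s * a = t * b → ∃ e, a = t * e ∧ b = s * e)
    (hs : ∀ v, s • v ∈ N ⊔ P) (ht : ∀ v, t • v ∈ N ⊔ P) (v : Fin 2 → R) :
    ∃ e, s • e ∈ N ∧ s • (v - e) ∈ P := by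
  obtain ⟨n, hn, p, hp, h1⟩ := Submodule.mem_sup.1 (hs v)
  obtain ⟨n', hn', p', hp', h2⟩ := Submodule.mem_sup.1 (ht v)
  have key : s • n' - t • n ∈ N ⊓ P := by
    refine ⟨sub_mem (N.smul_mem _ hn') (N.smul_mem _ hn), ?_⟩
    have : s • n' - t • n = t • p - s • p' := by
      rw [eq_sub_of_add_eq h1, eq_sub_of_add_eq h2, smul_sub, smul_sub, smul_comm s t]
      abel
    rw [this]
    exact sub_mem (P.smul_mem _ hp) (P.smul_mem _ hp')
  rw [h, Submodule.mem_bot, sub_eq_zero] at key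
  have : ∀ i, ∃ e, n' i = t * e ∧ n i = s * e := fun i => hst _ _ (congrFun key i)
  choose e _ he using this
  have hne : n = s • e := funext he
  refine ⟨e, hne ▸ hn, ?_⟩
  rwa [smul_sub, ← hne, ← h1, add_sub_cancel_left]

lemma exists_basis_of_decomposition [IsLocalRing R] [IsDomain R]
    {N P : Submodule R (Fin 2 → R)} (h : N ⊓ P = ⊥) (hN : N ≠ ⊥) (hP : P ≠ ⊥) {s t : R}
    (hs0 : s ≠ 0) (hst : ∀ a b, s * a = t * b → ∃ e, a = t * e ∧ b = s * e)
    (hs : ∀ v, s • v ∈ N ⊔ P) (ht : ∀ v, t • v ∈ N ⊔ P) :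
    ∃ n p, det2 n p = 1 ∧ (∀ v ∈ N, ∃ r : R, v = r • n) ∧ ∀ v ∈ P, ∃ r : R, v = r • p := by
  have hdet : ∀ {Q : Submodule R (Fin 2 → R)}, (∀ v ∈ Q, ∀ w ∈ Q, det2 v w = 0) →
      ∀ v w, s • v ∈ Q → s • w ∈ Q → det2 v w = 0 := by
    intro Q hQ v w hv hw
    have h1 : det2 (s • v) (s • w) = s * (s * det2 v w) := by simp [det2]; ring
    rw [hQ _ hv _ hw] at h1
    simpa [hs0] using h1.symm
  have hNd := hdet fun v hv w hw => det2_eq_zero_of_disjoint h hP hv hw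
  have hPd := hdet fun v hv w hw => det2_eq_zero_of_disjoint (inf_comm N P ▸ h) hN hv hw
  obtain ⟨e, heN, heP⟩ := exists_smul_decomposition h hst hs ht ![1, 0]
  obtain ⟨e', heN', heP'⟩ := exists_smul_decomposition h hst hs ht ![0, 1]
  obtain ⟨n, p, hn, hp, hu⟩ : ∃ n p, s • n ∈ N ∧ s • p ∈ P ∧ IsUnit (det2 n p) := by
    have h1 := hNd _ _ heN heN'
    have h2 := hPd _ _ heP heP'
    have h3 : det2 e (![0, 1] - e') + -det2 e' (![1, 0] - e) = 1 := by
      simp [det2] at h1 h2 ⊢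
      linear_combination -h1 - h2
    rcases IsLocalRing.isUnit_or_isUnit_of_add_one h3 with hu | hu
    · exact ⟨e, _, heN, heP', hu⟩
    · exact ⟨e', _, heN', heP, by simpa using hu⟩
  obtain ⟨u, hu⟩ := hu.exists_left_inv
  have hn' : s • (u • n) ∈ N := by
    rw [smul_comm]
    exact N.smul_mem _ hn
  have h1 : det2 (u • n) p = 1 := by
    rw [← hu]
    simp [det2]
    ring
  refine ⟨u • n, p, h1, fun v hv => ⟨det2 v p, ?_⟩, fun v hv => ⟨det2 (u • n) v, ?_⟩⟩
  · have := det2_smul_eq (u • n) p v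
    rwa [h1, one_smul, hNd _ _ hn' (N.smul_mem s hv), zero_smul, add_zero] at this
  · have := det2_smul_eq (u • n) p v
    rwa [h1, one_smul, hPd _ _ (P.smul_mem s hv) hp, zero_smul, zero_add] at this

lemma minorsIdeal_eq_mul {N P : Submodule R (Fin 2 → R)} {n p : Fin 2 → R}
    (h : det2 n p = 1) (hN : ∀ v ∈ N, ∃ r : R, v = r • n) (hP : ∀ v ∈ P, ∃ r : R, v = r • p) :
    minorsIdeal (N ⊔ P) = N.comap (LinearMap.toSpanSingleton R _ n) *
      P.comap (LinearMap.toSpanSingleton R _ p) := by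
  rw [det2] at h
  apply le_antisymm
  · rw [minorsIdeal, Ideal.span_le]
    rintro _ ⟨v, hv, w, hw, rfl⟩
    obtain ⟨v₁, hv₁, v₂, hv₂, rfl⟩ := Submodule.mem_sup.1 hv
    obtain ⟨w₁, hw₁, w₂, hw₂, rfl⟩ := Submodule.mem_sup.1 hw
    obtain ⟨a, rfl⟩ := hN _ hv₁
    obtain ⟨b, rfl⟩ := hP _ hv₂
    obtain ⟨c, rfl⟩ := hN _ hw₁
    obtain ⟨d, rfl⟩ := hP _ hw₂
    have e : det2 (a • n + b • p) (c • n + d • p) = a * d - c * b := by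
      simp [det2]
      linear_combination (a * d - c * b) * h
    rw [e]
    exact sub_mem (Ideal.mul_mem_mul hv₁ hw₂) (Ideal.mul_mem_mul hw₁ hv₂)
  · rw [Ideal.mul_le]
    intro a ha b hb
    refine Ideal.subset_span ⟨a • n, Submodule.mem_sup_left ha, b • p,
      Submodule.mem_sup_right hb, ?_⟩
    simp [det2]
    linear_combination (a * b) * h

end Decomposition

section Construction

/-- The vectors whose determinants against `(y, x)`, `(-a, y)` and all `(z, 0)` with `z * x ∈ I`
lie in `I`. -/
def contractedModule (I : Ideal R) (x y a : R) : Submodule R (Fin 2 → R) where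
  carrier := {v | v 0 * x - v 1 * y ∈ I ∧ v 0 * y + v 1 * a ∈ I ∧ ∀ z, z * x ∈ I → v 1 * z ∈ I}
  zero_mem' := by simp
  add_mem' := by
    rintro v w ⟨h1, h2, h3⟩ ⟨h1', h2', h3'⟩
    refine ⟨?_, ?_, fun z hz => ?_⟩
    · convert add_mem h1 h1' using 1
      simp only [Pi.add_apply]
      ring
    · convert add_mem h2 h2' using 1
      simp only [Pi.add_apply]
      ring
    · convert add_mem (h3 z hz) (h3' z hz) using 1
      simp only [Pi.add_apply]
      ring
  smul_mem' := by
    rintro c v ⟨h1, h2, h3⟩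
    refine ⟨?_, ?_, fun z hz => ?_⟩
    · convert I.mul_mem_left c h1 using 1
      simp only [Pi.smul_apply, smul_eq_mul]
      ring
    · convert I.mul_mem_left c h2 using 1
      simp only [Pi.smul_apply, smul_eq_mul]
      ring
    · convert I.mul_mem_left c (h3 z hz) using 1
      simp only [Pi.smul_apply, smul_eq_mul]
      ring

variable {I : Ideal R} {x y a : R}

lemma smul_mem_contractedModule {s : R} (hs : s ∈ I) (v : Fin 2 → R) :
    s • v ∈ contractedModule I x y a := by
  simp only [contractedModule, Submodule.mem_mk, AddSubmonoid.mem_mk, AddSubsemigroup.mem_mk,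
    Set.mem_ofPred_eq, Pi.smul_apply, smul_eq_mul, mul_assoc, ← mul_sub, ← mul_add]
  exact ⟨I.mul_mem_right _ hs, I.mul_mem_right _ hs, fun z _ => I.mul_mem_right _ hs⟩

lemma fst_mem_contractedModule (hf : y ^ 2 + x * a ∈ I) :
    ![y, x] ∈ contractedModule I x y a := by
  refine ⟨?_, ?_, fun z hz => ?_⟩
  · simp [mul_comm]
  · simpa [pow_two] using hf
  · simpa [mul_comm] using hz

lemma snd_mem_contractedModule (hf : y ^ 2 + x * a ∈ I) (hcol : ∀ z, z * x ∈ I → z * y ∈ I) :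
    ![-a, y] ∈ contractedModule I x y a := by
  refine ⟨?_, ?_, fun z hz => ?_⟩
  · convert neg_mem hf using 1
    simp
    ring
  · convert I.zero_mem using 1
    simp
    ring
  · simpa [mul_comm] using hcol z hz

lemma colon_mem_contractedModule (hcol : ∀ z, z * x ∈ I → z * y ∈ I) {z : R} (hz : z * x ∈ I) :
    ![z, 0] ∈ contractedModule I x y a := by
  refine ⟨by simpa using hz, by simpa using hcol z hz, fun w _ => by simp⟩

lemma minorsIdeal_contractedModule [IsDomain R] [IsNoetherianRing R] (hI : I ≠ ⊥)
    (hicl : IsIntClIdeal I) (hf : y ^ 2 + x * a ∈ I) (hcol : ∀ z, z * x ∈ I → z * y ∈ I)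
    (hgen : ∀ g ∈ I, ∃ b h, g = b * (y ^ 2 + x * a) + h * x) :
    minorsIdeal (contractedModule I x y a) = I := by
  have hh : ∀ {b h}, b * (y ^ 2 + x * a) + h * x ∈ I → h * x ∈ I := fun {b h} hg => by
    simpa using sub_mem hg (I.mul_mem_left b hf)
  apply le_antisymm
  · rw [minorsIdeal, Ideal.span_le]
    rintro _ ⟨v, ⟨v1, v2, v3⟩, w, ⟨w1, w2, w3⟩, rfl⟩
    refine hicl _ (memIntClIdeal_of_forall_mul_mem_sq hI fun g hg => ?_)
    obtain ⟨b, h, rfl⟩ := hgen g hg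
    have hx := hh hg
    have e : det2 v w * (b * (y ^ 2 + x * a) + h * x) =
        b * ((v 0 * x - v 1 * y) * (w 0 * y + w 1 * a)
          - (v 0 * y + v 1 * a) * (w 0 * x - w 1 * y))
        + ((v 0 * x - v 1 * y) * (w 1 * h) - (v 1 * h) * (w 0 * x - w 1 * y)) := by
      simp only [det2]
      ring
    rw [e, pow_two]
    exact add_mem (Ideal.mul_mem_left _ _ (sub_mem (Ideal.mul_mem_mul v1 w2)
      (Ideal.mul_mem_mul v2 w1))) (sub_mem (Ideal.mul_mem_mul v1 (w3 h hx))
      (Ideal.mul_mem_mul (v3 h hx) w1))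
  · intro g hg
    obtain ⟨b, h, rfl⟩ := hgen g hg
    refine add_mem (Ideal.mul_mem_left _ _ (Ideal.subset_span ⟨_, fst_mem_contractedModule hf,
      _, snd_mem_contractedModule hf hcol, ?_⟩)) (Ideal.subset_span ⟨_,
      colon_mem_contractedModule hcol (hh hg), _, fst_mem_contractedModule hf, ?_⟩)
    · simp [det2]
      ring
    · simp [det2]

lemma isIntClMod_contractedModule (hicl : IsIntClIdeal I) (hf : y ^ 2 + x * a ∈ I)
    (hcol : ∀ z, z * x ∈ I → z * y ∈ I) (hmin : minorsIdeal (contractedModule I x y a) = I) :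
    IsIntClMod (contractedModule I x y a) := by
  intro v hv
  rw [MemIntClMod, hmin] at hv
  refine ⟨?_, ?_, fun z hz => ?_⟩
  · simpa [det2] using hicl _ (hv _ (fst_mem_contractedModule hf))
  · simpa [det2] using hicl _ (hv _ (snd_mem_contractedModule hf hcol))
  · simpa [det2] using hicl _ (hv _ (colon_mem_contractedModule hcol hz))

end Construction

section OrderTwo

variable [IsLocalRing R] {I : Ideal R} {x y : R}

lemma exists_regularParameters_monic (hm : maximalIdeal R = Ideal.span {x, y})
    (hord : I ≤ maximalIdeal R ^ 2 ∧ ¬ I ≤ maximalIdeal R ^ 3) :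
    ∃ x y b c, maximalIdeal R = Ideal.span {x, y} ∧ y ^ 2 + x * (b * y + c * x) ∈ I := by
  obtain ⟨f, hf, hf3⟩ := SetLike.not_le_iff_exists.1 hord.2
  obtain ⟨a, b, c, rfl⟩ := exists_of_mem_maximalIdeal_sq hm (hord.1 hf)
  have key : ∀ {x y a b c : R}, maximalIdeal R = Ideal.span {x, y} →
      a * x ^ 2 + b * (x * y) + c * y ^ 2 ∈ I → c ∉ maximalIdeal R →
      ∃ x y b c, maximalIdeal R = Ideal.span {x, y} ∧ y ^ 2 + x * (b * y + c * x) ∈ I := by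
    intro x y a b c hm hf hc
    obtain ⟨u, hu⟩ := (IsLocalRing.notMem_maximalIdeal.1 hc).exists_left_inv
    refine ⟨x, y, u * b, u * a, hm, ?_⟩
    convert I.mul_mem_left u hf using 1
    linear_combination -y ^ 2 * hu
  by_cases hc : c ∈ maximalIdeal R
  swap
  · exact key hm hf hc
  by_cases ha : a ∈ maximalIdeal R
  swap
  · exact key (a := c) (b := b) (c := a) (maximalIdeal_eq_span_swap hm)
      (by convert hf using 1; ring) ha
  have hb : b ∉ maximalIdeal R := by
    intro hb
    refine hf3 ?_
    have hx := mem_maximalIdeal_left hm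
    have hy := mem_maximalIdeal_right hm
    rw [pow_succ']
    refine add_mem (add_mem ?_ ?_) ?_
    · exact Ideal.mul_mem_mul ha (Ideal.pow_mem_pow hx 2)
    · exact Ideal.mul_mem_mul hb (pow_two (maximalIdeal R) ▸ Ideal.mul_mem_mul hx hy)
    · exact Ideal.mul_mem_mul hc (Ideal.pow_mem_pow hy 2)
  have hm' : maximalIdeal R = Ideal.span {x - y, y} := by
    rw [hm]
    apply le_antisymm <;>
      rw [Ideal.span_le, Set.insert_subset_iff, Set.singleton_subset_iff] <;>
      simp only [SetLike.mem_coe, Ideal.mem_span_pair]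
    · exact ⟨⟨1, 1, by ring⟩, ⟨0, 1, by ring⟩⟩
    · exact ⟨⟨1, -1, by ring⟩, ⟨0, 1, by ring⟩⟩
  refine key (a := a) (b := b + 2 * a) (c := a + b + c) hm' (by convert hf using 1; ring) ?_
  intro h
  have e : b = (a + b + c) - a - c := by ring
  exact hb (e ▸ sub_mem (sub_mem h ha) hc)

lemma exists_maximalIdeal_eq_span_pair (hm : maximalIdeal R = Ideal.span {x, y}) {l : R}
    (hl : l ∈ maximalIdeal R) (hl2 : l ∉ maximalIdeal R ^ 2) :
    ∃ l', maximalIdeal R = Ideal.span {l, l'} := by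
  obtain ⟨a, b, rfl⟩ := exists_of_mem_maximalIdeal hm hl
  have hx := mem_maximalIdeal_left hm
  have hy := mem_maximalIdeal_right hm
  have key : ∀ {x y a b : R}, maximalIdeal R = Ideal.span {x, y} → a ∉ maximalIdeal R →
      maximalIdeal R = Ideal.span {a * x + b * y, y} := by
    intro x y a b hm ha
    obtain ⟨u, hu⟩ := (IsLocalRing.notMem_maximalIdeal.1 ha).exists_left_inv
    rw [hm]
    apply le_antisymm <;>
      rw [Ideal.span_le, Set.insert_subset_iff, Set.singleton_subset_iff] <;>
      simp only [SetLike.mem_coe, Ideal.mem_span_pair]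
    · exact ⟨⟨u, -u * b, by linear_combination x * hu⟩, ⟨0, 1, by ring⟩⟩
    · exact ⟨⟨a, b, by ring⟩, ⟨0, 1, by ring⟩⟩
  by_cases ha : a ∈ maximalIdeal R
  · by_cases hb : b ∈ maximalIdeal R
    · refine absurd ?_ hl2
      rw [pow_two]
      exact add_mem (Ideal.mul_mem_mul ha hx) (Ideal.mul_mem_mul hb hy)
    · refine ⟨x, ?_⟩
      rw [add_comm]
      exact key (maximalIdeal_eq_span_swap hm) hb
  · exact ⟨y, key hm ha⟩

lemma not_le_sq_of_mul_not_le_cube {J K : Ideal R} (hK : K ≤ maximalIdeal R)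
    (h : ¬ J * K ≤ maximalIdeal R ^ 3) : ¬ J ≤ maximalIdeal R ^ 2 :=
  fun hJ => h (by rw [pow_succ]; exact Ideal.mul_mono hJ hK)

variable [IsNoetherianRing R]

lemma mul_right_mem_of_mul_left_mem (hdim : ringKrullDim R = 2)
    (hm : maximalIdeal R = Ideal.span {x, y}) (hicl : IsIntClIdeal I)
    (hI : I ≤ maximalIdeal R ^ 2) {b c : R} (hf : y ^ 2 + x * (b * y + c * x) ∈ I) {z : R}
    (hz : z * x ∈ I) : z * y ∈ I := by
  obtain ⟨r, s, rfl⟩ := exists_of_mem_maximalIdeal hm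
    (coeff_mem_of_linear_mem_sq hdim hm (s := z) (t := 0) (by simpa using hI hz)).1
  set z := r * x + s * y with hzdef
  refine hicl _ (memIntClIdeal_of_quadratic
    (b := b * (z * x) - s * (y ^ 2 + x * (b * y + c * x)))
    (c := c * (z * x * (z * x)) - r * (z * x * (y ^ 2 + x * (b * y + c * x)))) ?_ ?_ ?_)
  · exact sub_mem (I.mul_mem_left _ hz) (I.mul_mem_left _ hf)
  · rw [pow_two]
    exact sub_mem (Ideal.mul_mem_left _ _ (Ideal.mul_mem_mul hz hz))
      (Ideal.mul_mem_left _ _ (Ideal.mul_mem_mul hz hf))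
  · linear_combination (-z) * (y ^ 2 + x * (b * y + c * x)) * hzdef

lemma mem_span_sup_sq_of_mul_mem {l l' : R} (hdim : ringKrullDim R = 2)
    (hm : maximalIdeal R = Ideal.span {l, l'}) {j k : R} (hj : j ∈ maximalIdeal R)
    (hk : k ∈ maximalIdeal R) (hk2 : k ∉ maximalIdeal R ^ 2)
    (h : j * k ∈ Ideal.span {l ^ 2} ⊔ maximalIdeal R ^ 3) :
    j ∈ Ideal.span {l} ⊔ maximalIdeal R ^ 2 := by
  have hl := mem_maximalIdeal_left hm
  have hl' := mem_maximalIdeal_right hm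
  obtain ⟨a, b, rfl⟩ := exists_of_mem_maximalIdeal hm hj
  obtain ⟨c, d, rfl⟩ := exists_of_mem_maximalIdeal hm hk
  obtain ⟨_, he, r, hr, e⟩ := Submodule.mem_sup.1 h
  obtain ⟨q, rfl⟩ := Ideal.mem_span_singleton'.1 he
  obtain ⟨-, h1, h2⟩ := coeff_mem_of_quadratic_mem_cube hdim hm
    (a := a * c - q) (b := a * d + b * c) (c := b * d) (by convert hr using 1; linear_combination -e)
  by_cases hb : b ∈ maximalIdeal R
  · refine Submodule.add_mem_sup (Ideal.mul_mem_left _ _ (Ideal.mem_span_singleton_self l)) ?_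
    rw [pow_two]
    exact Ideal.mul_mem_mul hb hl'
  · have hd := mem_maximalIdeal_of_mul_mem h2 hb
    have hc : c ∈ maximalIdeal R := by
      refine mem_maximalIdeal_of_mul_mem ?_ hb
      simpa using sub_mem h1 (Ideal.mul_mem_left _ a hd)
    refine absurd ?_ hk2
    rw [pow_two]
    exact add_mem (Ideal.mul_mem_mul hc hl) (Ideal.mul_mem_mul hd hl')

/-- For a product of order two, whether the two factors generate the maximal ideal depends only on
the product. -/
lemma sup_ne_maximalIdeal_of_mul_eq_mul (hdim : ringKrullDim R = 2)
    (hm : maximalIdeal R = Ideal.span {x, y}) {J K J' K' : Ideal R}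
    (hJ : J ≤ maximalIdeal R) (hK : K ≤ maximalIdeal R) (hJ' : J' ≤ maximalIdeal R)
    (hK' : K' ≤ maximalIdeal R) (heq : J * K = J' * K') (hord : ¬ J * K ≤ maximalIdeal R ^ 3)
    (hne : J ⊔ K ≠ maximalIdeal R) : J' ⊔ K' ≠ maximalIdeal R := by
  obtain ⟨l, hl, hl2⟩ := SetLike.not_le_iff_exists.1 (not_le_sq_of_mul_not_le_cube hK hord)
  obtain ⟨l', hm'⟩ := exists_maximalIdeal_eq_span_pair hm (hJ hl) hl2
  have hlm := mem_maximalIdeal_left hm'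
  have hlm' := mem_maximalIdeal_right hm'
  have hle : J ⊔ K ≤ Ideal.span {l} ⊔ maximalIdeal R ^ 2 := by
    intro u hu
    obtain ⟨a, b, rfl⟩ := exists_of_mem_maximalIdeal hm' (sup_le hJ hK hu)
    refine Submodule.add_mem_sup (Ideal.mul_mem_left _ _ (Ideal.mem_span_singleton_self l)) ?_
    rw [pow_two]
    refine Ideal.mul_mem_mul ?_ hlm'
    by_contra hb
    refine hne (le_antisymm (sup_le hJ hK) ?_)
    have hlJK : l ∈ J ⊔ K := Ideal.mem_sup_left hl
    have hbl : b * l' ∈ J ⊔ K := by simpa using sub_mem hu (Ideal.mul_mem_left _ a hlJK)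
    rw [hm', Ideal.span_le, Set.insert_subset_iff, Set.singleton_subset_iff]
    exact ⟨hlJK, (Ideal.unit_mul_mem_iff_mem _ (IsLocalRing.notMem_maximalIdeal.1 hb)).1 hbl⟩
  have hprod : J * K ≤ Ideal.span {l ^ 2} ⊔ maximalIdeal R ^ 3 := by
    rw [Ideal.mul_le]
    intro u hu v hv
    obtain ⟨_, hu1, c, hc, rfl⟩ := Submodule.mem_sup.1 (hle (Ideal.mem_sup_left hu))
    obtain ⟨a, rfl⟩ := Ideal.mem_span_singleton'.1 hu1
    obtain ⟨_, hv1, d, hd, rfl⟩ := Submodule.mem_sup.1 (hle (Ideal.mem_sup_right hv))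
    obtain ⟨b, rfl⟩ := Ideal.mem_span_singleton'.1 hv1
    have e : (a * l + c) * (b * l + d) =
        (a * b) * l ^ 2 + (a * (d * l) + b * (c * l) + c * d) := by ring
    rw [e]
    refine Submodule.add_mem_sup (Ideal.mul_mem_left _ _ (Ideal.mem_span_singleton_self _)) ?_
    rw [pow_succ]
    exact add_mem (add_mem (Ideal.mul_mem_left _ _ (Ideal.mul_mem_mul hd hlm))
      (Ideal.mul_mem_left _ _ (Ideal.mul_mem_mul hc hlm)))
      (Ideal.mul_mem_mul hc (Ideal.pow_le_self two_ne_zero hd))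
  rw [heq] at hord hprod
  obtain ⟨j, hj, hj2⟩ := SetLike.not_le_iff_exists.1 (not_le_sq_of_mul_not_le_cube hK' hord)
  obtain ⟨k, hk, hk2⟩ := SetLike.not_le_iff_exists.1
    (not_le_sq_of_mul_not_le_cube hJ' (mul_comm J' K' ▸ hord))
  have hle' : J' ⊔ K' ≤ Ideal.span {l} ⊔ maximalIdeal R ^ 2 := by
    refine sup_le (fun u hu => ?_) (fun u hu => ?_)
    · exact mem_span_sup_sq_of_mul_mem hdim hm' (hJ' hu) (hK' hk) hk2
        (hprod (Ideal.mul_mem_mul hu hk))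
    · exact mem_span_sup_sq_of_mul_mem hdim hm' (hK' hu) (hJ' hj) hj2
        (hprod (mul_comm j u ▸ Ideal.mul_mem_mul hj hu))
  intro h
  obtain ⟨_, h1, r, hr, e⟩ := Submodule.mem_sup.1 (hle' (h ▸ hlm'))
  obtain ⟨q, rfl⟩ := Ideal.mem_span_singleton'.1 h1
  have := (coeff_mem_of_linear_mem_sq hdim hm' (s := -q) (t := 1)
    (by convert hr using 1; linear_combination -e)).2
  exact (Ideal.ne_top_iff_one _).1 (maximalIdeal.isMaximal R).ne_top this

end OrderTwo

theorem stmt11 [IsNoetherianRing R] [IsLocalRing R] [IsDomain R]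
    [Infinite (ResidueField R)]
    (hdim : ringKrullDim R = 2)
    (hreg : ∃ x y : R, maximalIdeal R = Ideal.span {x, y})
    (I : Ideal R) (hicl : IsIntClIdeal I) (hprim : I.radical = maximalIdeal R)
    (hord : I ≤ maximalIdeal R ^ 2 ∧ ¬ I ≤ maximalIdeal R ^ 3)
    (hcase : IsSimpleIdeal I ∨
      ∃ J K : Ideal R, IsSimpleIdeal J ∧ IsSimpleIdeal K ∧
        IsIntClIdeal J ∧ IsIntClIdeal K ∧
        J.radical = maximalIdeal R ∧ K.radical = maximalIdeal R ∧
        I = J * K ∧ J ⊔ K ≠ maximalIdeal R) :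
    ∃ M : Submodule R (Fin 2 → R), M.FG ∧ minorsIdeal M ≠ ⊥ ∧
      IsIntClMod M ∧ IsIndecomposable M ∧ minorsIdeal M = I := by
  obtain ⟨x₀, y₀, hm₀⟩ := hreg
  obtain ⟨x, y, b, c, hm, hf⟩ := exists_regularParameters_monic hm₀ hord
  have hcol : ∀ z, z * x ∈ I → z * y ∈ I := fun z hz =>
    mul_right_mem_of_mul_left_mem hdim hm hicl hord.1 hf hz
  have hI : I ≠ ⊥ := by
    rintro rfl
    exact hord.2 bot_le
  have hgen : ∀ g ∈ I, ∃ q h, g = q * (y ^ 2 + x * (b * y + c * x)) + h * x := by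
    intro g hg
    obtain ⟨α, β, γ, rfl⟩ := exists_of_mem_maximalIdeal_sq hm (hord.1 hg)
    exact ⟨γ, α * x + β * y - γ * (b * y + c * x), by ring⟩
  have hmin := minorsIdeal_contractedModule hI hicl hf hcol hgen
  have hfst := fst_mem_contractedModule hf
  refine ⟨contractedModule I x y (b * y + c * x), IsNoetherian.noetherian _, by rwa [hmin],
    isIntClMod_contractedModule hicl hf hcol hmin, fun N P hNP hdisj => ?_, hmin⟩
  by_contra! hne
  have hcoord : ∀ v ∈ contractedModule I x y (b * y + c * x),
      v 0 ∈ maximalIdeal R ∧ v 1 ∈ maximalIdeal R := by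
    intro v hv
    have := coeff_mem_of_linear_mem_sq hdim hm (s := v 0) (t := -v 1)
      (by simpa [sub_eq_add_neg] using hord.1 hv.1)
    simpa using this
  obtain ⟨k, hk⟩ := Ideal.exists_pow_le_of_le_radical_of_fg hprim.ge (IsNoetherian.noetherian _)
  have hxI : x ^ k ∈ I := hk (Ideal.pow_mem_pow (mem_maximalIdeal_left hm) k)
  have hyI : y ^ k ∈ I := hk (Ideal.pow_mem_pow (mem_maximalIdeal_right hm) k)
  have hx := prime_regularParameter hdim hm
  have hx0 : x ^ k ≠ 0 := pow_ne_zero k hx.ne_zero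
  obtain ⟨n, p, hdet, hN, hP⟩ := exists_basis_of_decomposition hdisj hne.1 hne.2
    (s := x ^ k) (t := y ^ k) hx0 (fun a b hab => by
      obtain ⟨e, rfl⟩ := hx.pow_dvd_of_dvd_mul_left k (a := y ^ k) (b := b)
        (fun h => right_notMem_span_left hdim hm k (Ideal.mem_span_singleton.2 h)) ⟨a, hab.symm⟩
      exact ⟨e, mul_left_cancel₀ hx0 (by linear_combination hab), rfl⟩)
    (fun v => hNP ▸ smul_mem_contractedModule hxI v)
    (fun v => hNP ▸ smul_mem_contractedModule hyI v)
  have hprod := minorsIdeal_eq_mul hdet hN hP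
  rw [hNP, hmin] at hprod
  set J := N.comap (LinearMap.toSpanSingleton R _ n) with hJdef
  set K := P.comap (LinearMap.toSpanSingleton R _ p) with hKdef
  have hone : (1 : R) ∉ maximalIdeal R :=
    (Ideal.ne_top_iff_one _).1 (maximalIdeal.isMaximal R).ne_top
  have hJ : J ≠ ⊤ := by
    intro h
    have h1 : (1 : R) ∈ J := h ▸ Submodule.mem_top
    have h2 := hcoord n (hNP ▸ Submodule.mem_sup_left (by simpa [hJdef] using h1))
    rw [det2] at hdet
    exact hone (hdet ▸ sub_mem (Ideal.mul_mem_right _ _ h2.1) (Ideal.mul_mem_right _ _ h2.2))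
  have hK : K ≠ ⊤ := by
    intro h
    have h1 : (1 : R) ∈ K := h ▸ Submodule.mem_top
    have h2 := hcoord p (hNP ▸ Submodule.mem_sup_right (by simpa [hKdef] using h1))
    rw [det2] at hdet
    exact hone (hdet ▸ sub_mem (Ideal.mul_mem_left _ _ h2.2) (Ideal.mul_mem_left _ _ h2.1))
  rcases hcase with hsimple | ⟨J₀, K₀, hJ₀, hK₀, -, -, -, -, hprod₀, hsup₀⟩
  · exact (hsimple.2 J K hprod).elim hJ hK
  · refine sup_ne_maximalIdeal_of_mul_eq_mul hdim hm (le_maximalIdeal hJ₀.1)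
      (le_maximalIdeal hK₀.1) (le_maximalIdeal hJ) (le_maximalIdeal hK)
      (hprod₀.symm.trans hprod) (hprod₀ ▸ hord.2) hsup₀
      (le_antisymm (sup_le (le_maximalIdeal hJ) (le_maximalIdeal hK)) ?_)
    rw [← hNP] at hfst
    obtain ⟨v, hv, w, hw, e⟩ := Submodule.mem_sup.1 hfst
    obtain ⟨r, rfl⟩ := hN v hv
    obtain ⟨s, rfl⟩ := hP w hw
    have hr : r ∈ J ⊔ K := Ideal.mem_sup_left hv
    have hs : s ∈ J ⊔ K := Ideal.mem_sup_right hw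
    have hentry : ∀ i, ![y, x] i ∈ J ⊔ K := fun i => by
      rw [← e]
      exact add_mem (Ideal.mul_mem_right _ _ hr) (Ideal.mul_mem_right _ _ hs)
    rw [hm, Ideal.span_le, Set.insert_subset_iff, Set.singleton_subset_iff]
    exact ⟨hentry 1, hentry 0⟩
end

section
/- Let R be a two-dimensional regular local ring with m = (x, y), m, n >= 2, and I = (x^m, x y, y^n). Then (I : m) = (x^{m-1}, x y, y^{n-1}), (I : y) = (x, y^{n-1}), (I : y^2) = (x, y^{n-2}), and (I : x^2) = (x^{m-2}, y). -/
open IsLocalRing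

variable {R : Type*} [CommRing R]

theorem Ideal.mem_span_triple_iff {a b c z : R} :
    z ∈ Ideal.span {a, b, c} ↔ ∃ p q r, p * a + q * b + r * c = z := by
  simp only [Ideal.mem_span_insert, Ideal.mem_span_singleton']
  constructor
  · rintro ⟨p, _, ⟨q, _, ⟨r, rfl⟩, rfl⟩, rfl⟩
    exact ⟨p, q, r, by ring⟩
  · rintro ⟨p, q, r, rfl⟩
    exact ⟨p, _, ⟨q, _, ⟨r, rfl⟩, rfl⟩, by ring⟩

/-- In a Noetherian local ring of dimension at least two whose maximal ideal is generated by
`x` and `y`, the element `y` is a nonzerodivisor modulo `x`. -/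
theorem dvd_of_dvd_mul_of_maximalIdeal_eq_span_pair [IsNoetherianRing R] [IsLocalRing R]
    (hdim : 2 ≤ ringKrullDim R) {x y : R} (hmax : maximalIdeal R = Ideal.span {x, y})
    {r : R} (h : x ∣ y * r) : x ∣ r := by
  have hx : x ∈ maximalIdeal R := hmax ▸ Ideal.subset_span (by simp)
  have hy : y ∈ maximalIdeal R := hmax ▸ Ideal.subset_span (by simp)
  obtain ⟨P, hP⟩ := (Ideal.span {x}).nonempty_minimalPrimes
    (by simpa [Ideal.span_singleton_eq_top] using hx)
  have hprime : P.IsPrime := hP.isPrime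
  have hxP : x ∈ P := hP.1.2 (Ideal.mem_span_singleton_self x)
  have hyP : y ∉ P := by
    intro hyP
    have hPm : P = maximalIdeal R := le_antisymm (le_maximalIdeal hprime.ne_top) <| by
      rw [hmax, Ideal.span_le]
      rintro z (rfl | rfl) <;> assumption
    have h1 := Ideal.height_le_one_of_isPrincipal_of_mem_minimalPrimes _ P hP
    have h2 := maximalIdeal_height_eq_ringKrullDim (R := R)
    rw [← hPm] at h2
    rw [← h2] at hdim
    have h3 : (2 : ℕ∞) ≤ P.height := WithBot.coe_le_coe.1 hdim
    exact absurd (h3.trans h1) (by decide)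
  have hle : P ≤ Ideal.span {x} := by
    refine Submodule.le_of_le_smul_of_le_jacobson_bot (IsNoetherian.noetherian P)
      (IsLocalRing.jacobson_eq_maximalIdeal (R := R) _ bot_ne_top).ge fun p hp ↦ ?_
    have hpm := le_maximalIdeal hprime.ne_top hp
    rw [hmax, Ideal.mem_span_pair] at hpm
    obtain ⟨a, b, rfl⟩ := hpm
    have hb : b ∈ P := by
      have : b * y ∈ P := (P.add_mem_iff_right (P.mul_mem_left a hxP)).1 hp
      exact (hprime.mem_or_mem this).resolve_right hyP
    refine Submodule.add_mem_sup (Ideal.mul_mem_left _ a (Ideal.mem_span_singleton_self x)) ?_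
    rw [mul_comm b y]
    exact Submodule.smul_mem_smul hy hb
  exact Ideal.mem_span_singleton.1 <| hle <|
    (hprime.mem_or_mem (P.mem_of_dvd h hxP)).resolve_left hyP

theorem dvd_of_dvd_pow_mul {x y : R} (hxy : ∀ r, x ∣ y * r → x ∣ r) (j : ℕ) {r : R}
    (h : x ∣ y ^ j * r) : x ∣ r := by
  induction j with
  | zero => simpa using h
  | succ j ih => exact ih (hxy _ (by rwa [← mul_assoc, ← pow_succ']))

theorem Ideal.colon_span_pow_right {x y : R} (hxy : ∀ r, x ∣ y * r → x ∣ r) (j k l : ℕ) :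
    (Ideal.span {x ^ (k + 1), x * y, y ^ (l + (j + 1))}).colon (Ideal.span {y ^ (j + 1)}) =
      Ideal.span {x, y ^ l} := by
  ext r
  rw [Ideal.mem_colon_span_singleton, Ideal.mem_span_triple_iff, Ideal.mem_span_pair]
  constructor
  · rintro ⟨a, b, c, h⟩
    obtain ⟨e, he⟩ : x ∣ r - c * y ^ l := by
      refine dvd_of_dvd_pow_mul hxy (j + 1) ⟨a * x ^ k + b * y, ?_⟩
      linear_combination -h
    exact ⟨e, c, by linear_combination -he⟩
  · rintro ⟨a, b, rfl⟩
    exact ⟨0, a * y ^ j, b, by ring⟩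

theorem Ideal.colon_span_pow_left {x y : R} (hyx : ∀ r, y ∣ x * r → y ∣ r) (j k l : ℕ) :
    (Ideal.span {x ^ (k + (j + 1)), x * y, y ^ (l + 1)}).colon (Ideal.span {x ^ (j + 1)}) =
      Ideal.span {x ^ k, y} := by
  rw [Ideal.span_pair_comm, ← Ideal.colon_span_pow_right hyx j l k]
  congr 2
  rw [mul_comm x y, Set.insert_comm, Set.pair_comm, Set.insert_comm]

theorem Ideal.colon_span_pair {x y : R} (hxy : ∀ r, x ∣ y * r → x ∣ r)
    (hyx : ∀ r, y ∣ x * r → y ∣ r) (k l : ℕ) :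
    (Ideal.span {x ^ (k + 2), x * y, y ^ (l + 2)}).colon (Ideal.span {x, y}) =
      Ideal.span {x ^ (k + 1), x * y, y ^ (l + 1)} := by
  have h1 := Ideal.colon_span_pow_left hyx 0 (k + 1) (l + 1)
  have h2 := Ideal.colon_span_pow_right hxy 0 (k + 1) (l + 1)
  simp only [zero_add, pow_one, Ideal.colon_span] at h1 h2
  rw [Ideal.colon_span, ← Set.singleton_union (a := x) (s := {y}), Submodule.colon_union, h1, h2]
  ext r
  rw [Ideal.mem_inf, Ideal.mem_span_triple_iff, Ideal.mem_span_pair, Ideal.mem_span_pair]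
  constructor
  · rintro ⟨⟨c, d, rfl⟩, a, b, h⟩
    obtain ⟨e, he⟩ : x ∣ d - b * y ^ l := by
      refine hxy _ ⟨a - c * x ^ k, ?_⟩
      linear_combination -h
    exact ⟨c, e, b, by linear_combination -y * he⟩
  · rintro ⟨a, b, c, rfl⟩
    exact ⟨⟨a, b * x + c * y ^ l, by ring⟩, a * x ^ k + b * y, c, by ring⟩

theorem stmt13 [IsNoetherianRing R] [IsLocalRing R] [IsDomain R]
    (hdim : ringKrullDim R = 2)
    (x y : R) (hmax : maximalIdeal R = Ideal.span {x, y})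
    (m n : ℕ) (hm : 2 ≤ m) (hn : 2 ≤ n) :
    (Ideal.span {x ^ m, x * y, y ^ n}).colon (maximalIdeal R) =
        Ideal.span {x ^ (m - 1), x * y, y ^ (n - 1)} ∧
      (Ideal.span {x ^ m, x * y, y ^ n}).colon (Ideal.span {y}) =
        Ideal.span {x, y ^ (n - 1)} ∧
      (Ideal.span {x ^ m, x * y, y ^ n}).colon (Ideal.span {y ^ 2}) =
        Ideal.span {x, y ^ (n - 2)} ∧
      (Ideal.span {x ^ m, x * y, y ^ n}).colon (Ideal.span {x ^ 2}) =
        Ideal.span {x ^ (m - 2), y} := by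
  have hxy (r : R) : x ∣ y * r → x ∣ r :=
    dvd_of_dvd_mul_of_maximalIdeal_eq_span_pair hdim.ge hmax
  have hyx (r : R) : y ∣ x * r → y ∣ r :=
    dvd_of_dvd_mul_of_maximalIdeal_eq_span_pair hdim.ge (hmax.trans Ideal.span_pair_comm)
  obtain ⟨k, rfl⟩ := Nat.exists_eq_add_of_le' hm
  obtain ⟨l, rfl⟩ := Nat.exists_eq_add_of_le' hn
  refine ⟨?_, ?_, ?_, ?_⟩
  · rw [hmax]
    exact Ideal.colon_span_pair hxy hyx k l
  · simpa using Ideal.colon_span_pow_right hxy 0 (k + 1) (l + 1)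
  · exact Ideal.colon_span_pow_right hxy 1 (k + 1) l
  · exact Ideal.colon_span_pow_left hyx 1 k (l + 1)
end

section
/- Let R be a two-dimensional regular local ring with m = (x, y) and m, n >= 2. Then the ideal I = (x^m, x y, y^n) is integrally closed and equals the product (x, y^{n-1}) · (x^{m-1}, y). -/
open IsLocalRing

variable {R : Type*} [CommRing R]

section PrincipalMaximal

variable {S : Type*} [CommRing S]

theorem MemIntClIdeal.map_of_le {I : Ideal R} {J : Ideal S} (f : R →+* S) (h : I.map f ≤ J)
    {r : R} (hr : MemIntClIdeal I r) : MemIntClIdeal J (f r) := by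
  obtain ⟨n, hn, c, hc, heq⟩ := hr
  refine ⟨n, hn, fun i => f (c i), fun i h1 h2 => ?_, ?_⟩
  · have := Ideal.mem_map_of_mem f (hc i h1 h2)
    rw [Ideal.map_pow] at this
    exact Ideal.pow_right_mono h i this
  · simpa using congrArg f heq

variable {t : S}

theorem pow_dvd_or_eq_pow_mul_unit (hS : ∀ s : S, IsUnit s ∨ t ∣ s) (m : ℕ) (r : S) :
    t ^ m ∣ r ∨ ∃ k < m, ∃ u : S, IsUnit u ∧ r = t ^ k * u := by
  induction m with
  | zero => simp
  | succ m ih =>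
    rcases ih with ⟨u, rfl⟩ | ⟨k, hk, u, hu, rfl⟩
    · rcases hS u with hu | hu
      · exact .inr ⟨m, m.lt_succ_self, u, hu, rfl⟩
      · exact .inl (by rw [pow_succ]; exact mul_dvd_mul_left _ hu)
    · exact .inr ⟨k, hk.trans m.lt_succ_self, u, hu, rfl⟩

theorem not_pow_succ_dvd_pow_mul_unit (hS : ∀ s : S, IsUnit s ∨ t ∣ s) (ht : ¬ IsNilpotent t)
    (htu : ¬ IsUnit t) (k : ℕ) {u : S} (hu : IsUnit u) : ¬ t ^ (k + 1) ∣ t ^ k * u := by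
  rintro ⟨b, hb⟩
  have hz : t ^ k * (u - t * b) = 0 := by linear_combination hb
  rcases hS (u - t * b) with h | h
  · exact ht ⟨k, (h.mul_left_eq_zero).mp hz⟩
  · have : t ∣ u := by simpa using dvd_add h (dvd_mul_right t b)
    exact htu (isUnit_of_dvd_unit this hu)

theorem isIntClIdeal_span_pow (hS : ∀ s : S, IsUnit s ∨ t ∣ s) (ht : ¬ IsNilpotent t)
    (htu : ¬ IsUnit t) (m : ℕ) : IsIntClIdeal (Ideal.span {t ^ m}) := by
  rintro r ⟨n, hn, c, hc, heq⟩
  rw [Ideal.mem_span_singleton]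
  rcases pow_dvd_or_eq_pow_mul_unit hS m r with h | ⟨k, hk, u, hu, rfl⟩
  · exact h
  refine absurd ?_ (not_pow_succ_dvd_pow_mul_unit hS ht htu (k * n) (hu.pow n))
  rw [pow_mul, ← mul_pow, eq_neg_of_add_eq_zero_left heq, dvd_neg]
  refine Finset.dvd_sum fun i hi => ?_
  obtain ⟨h1, h2⟩ := Finset.mem_Icc.mp hi
  have hci := hc i h1 h2
  rw [Ideal.span_singleton_pow, Ideal.mem_span_singleton, ← pow_mul] at hci
  have hr : t ^ (k * (n - i)) ∣ (t ^ k * u) ^ (n - i) := by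
    rw [mul_pow, ← pow_mul]
    exact dvd_mul_right _ _
  refine (pow_dvd_pow t ?_).trans (pow_add t _ _ ▸ mul_dvd_mul hci hr)
  obtain ⟨j, rfl⟩ := Nat.exists_eq_add_of_le h2
  rw [Nat.add_sub_cancel_left]
  nlinarith

theorem pow_dvd_of_pow_succ_dvd_mul (hS : ∀ s : S, IsUnit s ∨ t ∣ s) (ht : ¬ IsNilpotent t)
    (htu : ¬ IsUnit t) (n : ℕ) {a : S} (h : t ^ (n + 1) ∣ t * a) : t ^ n ∣ a := by
  rcases pow_dvd_or_eq_pow_mul_unit hS n a with h' | ⟨k, hk, u, hu, rfl⟩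
  · exact h'
  refine absurd ((pow_dvd_pow t ?_).trans h) (?_ : ¬ t ^ (k + 1 + 1) ∣ _)
  · omega
  rw [← mul_assoc, ← pow_succ']
  exact not_pow_succ_dvd_pow_mul_unit hS ht htu (k + 1) hu

end PrincipalMaximal

section ParameterSystem

variable [IsLocalRing R] {x y : R}

theorem isUnit_or_dvd_mk_of_maximalIdeal_eq (hmax : maximalIdeal R = Ideal.span {x, y})
    (s : R ⧸ Ideal.span {y}) : IsUnit s ∨ Ideal.Quotient.mk (Ideal.span {y}) x ∣ s := by
  obtain ⟨a, rfl⟩ := Ideal.Quotient.mk_surjective s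
  by_cases ha : IsUnit a
  · exact .inl (ha.map _)
  have ha' : a ∈ Ideal.span {x, y} := hmax ▸ (mem_maximalIdeal a).mpr ha
  obtain ⟨b, c, rfl⟩ := Ideal.mem_span_pair.mp ha'
  have hy : Ideal.Quotient.mk (Ideal.span {y}) y = 0 :=
    Ideal.Quotient.eq_zero_iff_mem.mpr (Ideal.mem_span_singleton_self y)
  exact .inr (by simp [hy])

theorem not_isUnit_mk_of_maximalIdeal_eq (hmax : maximalIdeal R = Ideal.span {x, y}) :
    ¬ IsUnit (Ideal.Quotient.mk (Ideal.span {y}) x) := by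
  intro h
  obtain ⟨b, hb⟩ := h.exists_right_inv
  obtain ⟨b, rfl⟩ := Ideal.Quotient.mk_surjective b
  rw [← map_mul, ← map_one (Ideal.Quotient.mk (Ideal.span {y})), Ideal.Quotient.eq] at hb
  obtain ⟨c, hc⟩ := Ideal.mem_span_singleton.mp hb
  refine (Ideal.ne_top_iff_one _).mp (maximalIdeal.isMaximal R).ne_top ?_
  rw [hmax, Ideal.mem_span_pair]
  exact ⟨b, -c, by linear_combination hc⟩

theorem not_isNilpotent_mk_of_maximalIdeal_eq [IsNoetherianRing R] (hdim : ringKrullDim R = 2)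
    (hmax : maximalIdeal R = Ideal.span {x, y}) :
    ¬ IsNilpotent (Ideal.Quotient.mk (Ideal.span {y}) x) := by
  rintro ⟨k, hk⟩
  rw [← map_pow, Ideal.Quotient.eq_zero_iff_mem] at hk
  have hmin : maximalIdeal R ∈ (Ideal.span {y}).minimalPrimes := by
    refine ⟨⟨inferInstance, ?_⟩, fun q hq _ => ?_⟩
    · rw [hmax]
      exact Ideal.span_mono (by simp)
    · rw [hmax, Ideal.span_le, Set.insert_subset_iff, Set.singleton_subset_iff]
      exact ⟨hq.1.mem_of_pow_mem k (hq.2 hk), hq.2 (Ideal.mem_span_singleton_self y)⟩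
  have h1 := Ideal.height_le_one_of_isPrincipal_of_mem_minimalPrimes _ _ hmin
  have h2 : ((maximalIdeal R).height : WithBot ℕ∞) = 2 :=
    maximalIdeal_height_eq_ringKrullDim.trans hdim
  rw [show (maximalIdeal R).height = 2 from WithBot.coe_injective h2] at h1
  exact absurd h1 (by decide)

theorem mk_pow_dvd_mk_of_memIntClIdeal [IsNoetherianRing R] (hdim : ringKrullDim R = 2)
    (hmax : maximalIdeal R = Ideal.span {x, y}) {m n : ℕ} (hn : n ≠ 0) {r : R}
    (hr : MemIntClIdeal (Ideal.span {x ^ m, x * y, y ^ n}) r) :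
    Ideal.Quotient.mk (Ideal.span {y}) x ^ m ∣ Ideal.Quotient.mk (Ideal.span {y}) r := by
  have hy : Ideal.Quotient.mk (Ideal.span {y}) y = 0 :=
    Ideal.Quotient.eq_zero_iff_mem.mpr (Ideal.mem_span_singleton_self y)
  rw [← Ideal.mem_span_singleton]
  refine isIntClIdeal_span_pow (isUnit_or_dvd_mk_of_maximalIdeal_eq hmax)
    (not_isNilpotent_mk_of_maximalIdeal_eq hdim hmax)
    (not_isUnit_mk_of_maximalIdeal_eq hmax) m _ (hr.map_of_le _ ?_)
  rw [Ideal.map_span, Ideal.span_le]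
  rintro _ ⟨z, rfl | rfl | rfl, rfl⟩
  · simp
  · simp [hy]
  · simp [hy, hn]

theorem isIntClIdeal_span_pow_mul_pow [IsNoetherianRing R] (hdim : ringKrullDim R = 2)
    (hmax : maximalIdeal R = Ideal.span {x, y}) {m n : ℕ} (hm : m ≠ 0) (hn : n ≠ 0) :
    IsIntClIdeal (Ideal.span {x ^ m, x * y, y ^ n}) := by
  intro r hr
  have hmax' : maximalIdeal R = Ideal.span {y, x} := by rw [hmax, Set.pair_comm]
  have hgen : ({x ^ m, x * y, y ^ n} : Set R) = {y ^ n, y * x, x ^ m} := by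
    rw [mul_comm x y]
    ext
    simp only [Set.mem_insert_iff, Set.mem_singleton_iff]
    tauto
  obtain ⟨n, rfl⟩ := Nat.exists_eq_add_one_of_ne_zero hn
  obtain ⟨m, rfl⟩ := Nat.exists_eq_add_one_of_ne_zero hm
  obtain ⟨b, hb⟩ := mk_pow_dvd_mk_of_memIntClIdeal hdim hmax hn hr
  have hry := mk_pow_dvd_mk_of_memIntClIdeal hdim hmax' hm (hgen ▸ hr)
  obtain ⟨b, rfl⟩ := Ideal.Quotient.mk_surjective b
  rw [← map_pow, ← map_mul, Ideal.Quotient.eq] at hb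
  obtain ⟨a, ha⟩ := Ideal.mem_span_singleton.mp hb
  obtain rfl : r = x ^ (m + 1) * b + y * a := by linear_combination ha
  have hx : Ideal.Quotient.mk (Ideal.span {x}) x = 0 :=
    Ideal.Quotient.eq_zero_iff_mem.mpr (Ideal.mem_span_singleton_self x)
  have hya : Ideal.Quotient.mk (Ideal.span {x}) y ^ (n + 1) ∣
      Ideal.Quotient.mk (Ideal.span {x}) y * Ideal.Quotient.mk (Ideal.span {x}) a := by
    simpa [hx] using hry
  obtain ⟨c, hc⟩ := pow_dvd_of_pow_succ_dvd_mul (isUnit_or_dvd_mk_of_maximalIdeal_eq hmax')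
    (not_isNilpotent_mk_of_maximalIdeal_eq hdim hmax')
    (not_isUnit_mk_of_maximalIdeal_eq hmax') n hya
  obtain ⟨c, rfl⟩ := Ideal.Quotient.mk_surjective c
  rw [← map_pow, ← map_mul, Ideal.Quotient.eq] at hc
  obtain ⟨d, hd⟩ := Ideal.mem_span_singleton.mp hc
  rw [Ideal.mem_span_insert]
  refine ⟨b, x * y * d + y ^ (n + 1) * c, Ideal.mem_span_pair.mpr ⟨d, c, by ring⟩, ?_⟩
  linear_combination y * hd

end ParameterSystem

theorem span_pow_mul_pow_eq_mul (x y : R) (m n : ℕ) :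
    Ideal.span {x ^ (m + 2), x * y, y ^ (n + 2)} =
      Ideal.span {x, y ^ (n + 1)} * Ideal.span {x ^ (m + 1), y} := by
  rw [Ideal.span_pair_mul_span_pair]
  apply le_antisymm <;> rw [Ideal.span_le]
  · rintro _ (rfl | rfl | rfl)
    · exact Ideal.subset_span (by simp [pow_succ'])
    · exact Ideal.subset_span (by simp)
    · exact Ideal.subset_span (by simp [pow_succ])
  · rintro _ (rfl | rfl | rfl | rfl)
    · exact Ideal.subset_span (by simp [pow_succ'])
    · exact Ideal.subset_span (by simp)
    · rw [show y ^ (n + 1) * x ^ (m + 1) = y ^ n * x ^ m * (x * y) by ring]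
      exact Ideal.mul_mem_left _ _ (Ideal.subset_span (by simp))
    · exact Ideal.subset_span (by simp [pow_succ])

theorem stmt14 [IsNoetherianRing R] [IsLocalRing R] [IsDomain R]
    (hdim : ringKrullDim R = 2)
    (x y : R) (hmax : maximalIdeal R = Ideal.span {x, y})
    (m n : ℕ) (hm : 2 ≤ m) (hn : 2 ≤ n) :
    IsIntClIdeal (Ideal.span {x ^ m, x * y, y ^ n}) ∧
      Ideal.span {x ^ m, x * y, y ^ n} =
        Ideal.span {x, y ^ (n - 1)} * Ideal.span {x ^ (m - 1), y} := by
  obtain ⟨m, rfl⟩ := Nat.exists_eq_add_of_le hm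
  obtain ⟨n, rfl⟩ := Nat.exists_eq_add_of_le hn
  refine ⟨isIntClIdeal_span_pow_mul_pow hdim hmax (by omega) (by omega), ?_⟩
  have h := span_pow_mul_pow_eq_mul x y m n
  rwa [show 2 + m = m + 1 + 1 by omega, show 2 + n = n + 1 + 1 by omega]
end

section
/- Let R be a two-dimensional regular local ring with m = (x, y), m, n >= 2, and I = (x^m, xy, y^n). If M is an integrally closed rank-two R-module without a free direct summand such that I(M) = I, then M is isomorphic to (x, y^{n-1}) ⊕ (x^{m-1}, y); in particular M is decomposable. -/
open IsLocalRing

variable {R : Type*} [CommRing R]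

theorem MemIntClIdeal.of_mem {I : Ideal R} {r : R} (hr : r ∈ I) : MemIntClIdeal I r := by
  refine ⟨1, one_pos, fun _ => -r, ?_, by simp⟩
  intro i h1 h2
  obtain rfl : i = 1 := le_antisymm h2 h1
  simpa using hr

theorem IsIntClMod.mem_of_det2_mem {M : Submodule R (Fin 2 → R)} (hM : IsIntClMod M)
    {v : Fin 2 → R} (hv : ∀ w ∈ M, det2 v w ∈ minorsIdeal M) : v ∈ M :=
  hM v fun w hw => .of_mem (hv w hw)

/-- In a two-dimensional local ring the maximal ideal is not minimal over a principal ideal. -/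
theorem maximalIdeal_notMem_minimalPrimes_span_singleton [IsNoetherianRing R] [IsLocalRing R]
    (hdim : ringKrullDim R = 2) (y : R) :
    maximalIdeal R ∉ (Ideal.span {y}).minimalPrimes := by
  intro hmin
  have hle := Ideal.height_le_one_of_isPrincipal_of_mem_minimalPrimes _ _ hmin
  have h2 : ((maximalIdeal R).height : WithBot ℕ∞) = ((2 : ℕ∞) : WithBot ℕ∞) := by
    rw [IsLocalRing.maximalIdeal_height_eq_ringKrullDim, hdim]
    rfl
  rw [WithBot.coe_injective h2] at hle
  exact absurd hle (by decide)

theorem not_dvd_pow_of_ringKrullDim_eq_two [IsNoetherianRing R] [IsLocalRing R]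
    (hdim : ringKrullDim R = 2) {x y : R} (hmax : maximalIdeal R = Ideal.span {x, y}) (k : ℕ) :
    ¬ y ∣ x ^ k := by
  intro h
  have hy : y ∈ maximalIdeal R := hmax ▸ Ideal.subset_span (by simp)
  refine maximalIdeal_notMem_minimalPrimes_span_singleton hdim y
    ⟨⟨inferInstance, by simpa [Ideal.span_le] using hy⟩, ?_⟩
  rintro q ⟨hq, hyq⟩ -
  have hyq' : y ∈ q := hyq (Ideal.mem_span_singleton_self y)
  have hxq : x ∈ q := hq.mem_of_pow_mem k (q.mem_of_dvd h hyq')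
  rw [hmax, Ideal.span_le]
  rintro z (rfl | rfl) <;> assumption

theorem dvd_of_dvd_mul_of_ringKrullDim_eq_two [IsNoetherianRing R] [IsLocalRing R]
    (hdim : ringKrullDim R = 2) {x y : R} (hmax : maximalIdeal R = Ideal.span {x, y}) {t : R}
    (h : y ∣ x * t) : y ∣ t := by
  by_contra ht
  have hx : x ∈ maximalIdeal R := hmax ▸ Ideal.subset_span (by simp)
  have hy : y ∈ maximalIdeal R := hmax ▸ Ideal.subset_span (by simp)
  have key : ∀ k : ℕ, ∃ u s, t = x ^ k * u + y * s := by
    intro k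
    induction k with
    | zero => exact ⟨t, 0, by simp⟩
    | succ k ih =>
      obtain ⟨u, s, hus⟩ := ih
      by_cases hu : IsUnit u
      · exfalso
        obtain ⟨c, hc⟩ := h
        have : y ∣ x ^ (k + 1) * u := ⟨c - x * s, by
          linear_combination hc - x * hus⟩
        exact not_dvd_pow_of_ringKrullDim_eq_two hdim hmax (k + 1) (hu.dvd_mul_right.mp this)
      · have hu' : u ∈ Ideal.span {x, y} := hmax ▸ (mem_maximalIdeal u).mpr hu
        obtain ⟨a, b, rfl⟩ := Ideal.mem_span_pair.mp hu'
        exact ⟨a, s + x ^ k * b, by rw [hus]; ring⟩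
  have hne : Ideal.span {y} ≠ ⊤ := fun h => by
    rw [Ideal.span_singleton_eq_top] at h
    exact (mem_maximalIdeal y).mp hy h
  have : Nontrivial (R ⧸ Ideal.span {y}) := Ideal.Quotient.nontrivial_iff.mpr hne
  have : IsLocalRing (R ⧸ Ideal.span {y}) :=
    .of_surjective' (Ideal.Quotient.mk (Ideal.span {y})) Ideal.Quotient.mk_surjective
  let π := Ideal.Quotient.mk (Ideal.span {y})
  have hx' : Ideal.span {π x} ≠ ⊤ := fun h => by
    rw [Ideal.span_singleton_eq_top] at h
    have : IsLocalHom π := IsLocalHom.of_surjective π Ideal.Quotient.mk_surjective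
    exact (mem_maximalIdeal x).mp hx (isUnit_of_map_unit π x h)
  have hinf := Ideal.iInf_pow_eq_bot_of_isLocalRing _ hx'
  have h0 : π t ∈ ⨅ i : ℕ, Ideal.span {π x} ^ i := by
    rw [Ideal.mem_iInf]
    intro k
    obtain ⟨u, s, hus⟩ := key k
    have hπy : π y = 0 := Ideal.Quotient.eq_zero_iff_mem.mpr (Ideal.mem_span_singleton_self y)
    rw [Ideal.span_singleton_pow, Ideal.mem_span_singleton]
    exact ⟨π u, by rw [hus]; simp [hπy]⟩
  rw [hinf, Ideal.mem_bot] at h0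
  exact ht (Ideal.mem_span_singleton.mp (Ideal.Quotient.eq_zero_iff_mem.mp h0))

theorem mul_notMem_span_sq_pair [IsNoetherianRing R] [IsLocalRing R] [IsDomain R]
    (hdim : ringKrullDim R = 2) {x y : R} (hmax : maximalIdeal R = Ideal.span {x, y}) :
    x * y ∉ Ideal.span {x ^ 2, y ^ 2} := by
  intro h
  obtain ⟨a, b, hab⟩ := Ideal.mem_span_pair.mp h
  have hreg {t : R} (h : y ∣ x * t) : y ∣ t :=
    dvd_of_dvd_mul_of_ringKrullDim_eq_two hdim hmax h
  have hyx : ¬ y ∣ x := by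
    simpa using not_dvd_pow_of_ringKrullDim_eq_two hdim hmax 1
  obtain ⟨a', rfl⟩ : y ∣ a :=
    hreg (hreg ⟨x - b * y, by linear_combination hab⟩)
  have hy : y ≠ 0 := fun h0 => by
    subst h0
    have hbot : maximalIdeal R = Ideal.span {x} := by rw [hmax, Set.pair_comm]; simp
    refine maximalIdeal_notMem_minimalPrimes_span_singleton hdim x ?_
    rw [← hbot, Ideal.minimalPrimes_eq_subsingleton_self]
    rfl
  have h1 : y ∣ x * (1 - a' * x) :=
    ⟨b, mul_left_cancel₀ hy (by linear_combination -hab)⟩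
  have hx : x ∈ maximalIdeal R := hmax ▸ Ideal.subset_span (by simp)
  have hunit : IsUnit (1 - a' * x) := by
    by_contra hnu
    refine (Ideal.ne_top_iff_one _).mp (maximalIdeal.isMaximal R).ne_top ?_
    simpa using add_mem ((mem_maximalIdeal _).mpr hnu) (Ideal.mul_mem_left _ a' hx)
  exact hyx (hunit.dvd_mul_right.mp h1)

theorem apply_mem_maximalIdeal_of_not_hasFreeSummand [IsLocalRing R] [IsDomain R]
    {M : Submodule R (Fin 2 → R)} (hM : ¬ HasFreeSummand M) {v : Fin 2 → R} (hv : v ∈ M)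
    (i : Fin 2) : v i ∈ maximalIdeal R := by
  by_contra hvi
  obtain ⟨c, hc⟩ : ∃ c, c * v i = 1 := (notMem_maximalIdeal.mp hvi).exists_left_inv
  have hv0 : v ≠ 0 := by
    rintro rfl
    simp at hc
  refine hM ⟨R ∙ v, M ⊓ LinearMap.ker (LinearMap.proj i), le_antisymm ?_ ?_, ?_, ?_, ?_⟩
  · exact sup_le ((Submodule.span_singleton_le_iff_mem v M).mpr hv) inf_le_left
  · intro w hw
    refine Submodule.mem_sup.mpr ⟨(w i * c) • v, Submodule.smul_mem _ _
      (Submodule.mem_span_singleton_self v), w - (w i * c) • v,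
      ⟨sub_mem hw (M.smul_mem _ hv), ?_⟩, by simp⟩
    simp [mul_assoc, hc]
  · rw [eq_bot_iff]
    rintro w ⟨hw, -, hwi⟩
    obtain ⟨a, rfl⟩ := Submodule.mem_span_singleton.mp hw
    have ha : a * v i = 0 := hwi
    have : a = 0 := by linear_combination c * ha - a * hc
    simp [this]
  · simpa using hv0
  · exact Module.Free.of_equiv (LinearEquiv.toSpanNonzeroSingleton R _ v hv0)

theorem mem_span_pow_pair_of_mul_mem {x y a : R} (hreg : ∀ t, y ∣ x * t → y ∣ t) (k : ℕ)
    (h : x * a ∈ Ideal.span {x ^ (k + 1), y}) : a ∈ Ideal.span {x ^ k, y} := by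
  obtain ⟨b, c, hbc⟩ := Ideal.mem_span_pair.mp h
  obtain ⟨d, hd⟩ := hreg (a - b * x ^ k) ⟨c, by linear_combination -hbc⟩
  exact Ideal.mem_span_pair.mpr ⟨b, d, by linear_combination -hd⟩

/-- Decomposition of a module along a basis `U, W` adapted to it. -/
theorem equiv_prod_and_not_isIndecomposable [IsDomain R] {M : Submodule R (Fin 2 → R)}
    {J K : Ideal R} (hJ : J ≠ ⊥) (hK : K ≠ ⊥) {U W : Fin 2 → R} (hUW : IsUnit (det2 U W))
    (hM : ∀ v, v ∈ M ↔ det2 v W ∈ J ∧ det2 U v ∈ K) :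
    Nonempty (M ≃ₗ[R] (↥J × ↥K)) ∧ ¬ IsIndecomposable M := by
  obtain ⟨c, hc⟩ := hUW.exists_left_inv
  let f : (Fin 2 → R) →ₗ[R] R :=
    W 1 • LinearMap.proj 0 - W 0 • LinearMap.proj 1
  let g : (Fin 2 → R) →ₗ[R] R :=
    U 0 • LinearMap.proj 1 - U 1 • LinearMap.proj 0
  have hf v : f v = det2 v W := by simp [f, det2]; ring
  have hg v : g v = det2 U v := by simp [g, det2]
  have hcomb (a b : R) : det2 ((c * a) • U + (c * b) • W) W = a ∧
      det2 U ((c * a) • U + (c * b) • W) = b := by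
    simp only [det2, Pi.add_apply, Pi.smul_apply, smul_eq_mul] at hc ⊢
    constructor
    · linear_combination a * hc
    · linear_combination b * hc
  have hrec (v : Fin 2 → R) : v = (c * det2 v W) • U + (c * det2 U v) • W := by
    ext i
    fin_cases i <;> simp [det2] at hc ⊢
    · linear_combination -v 0 * hc
    · linear_combination -v 1 * hc
  constructor
  · let φ : M →ₗ[R] (↥J × ↥K) :=
      LinearMap.prod
        ((f.comp M.subtype).codRestrict J fun v => by
          simpa [hf] using ((hM v).mp v.2).1)
        ((g.comp M.subtype).codRestrict K fun v => by
          simpa [hg] using ((hM v).mp v.2).2)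
    refine ⟨LinearEquiv.ofBijective φ ⟨?_, ?_⟩⟩
    · rw [injective_iff_map_eq_zero]
      intro v hv
      have h1 : f v = 0 := congrArg (fun p : ↥J × ↥K => (p.1 : R)) hv
      have h2 : g v = 0 := congrArg (fun p : ↥J × ↥K => (p.2 : R)) hv
      ext1
      rw [hrec v, ← hf, ← hg, h1, h2]
      simp
    · rintro ⟨⟨a, ha⟩, ⟨b, hb⟩⟩
      obtain ⟨h1, h2⟩ := hcomb a b
      refine ⟨⟨(c * a) • U + (c * b) • W, (hM _).mpr ⟨by rwa [h1], by rwa [h2]⟩⟩, ?_⟩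
      refine Prod.ext (Subtype.ext ((hf _).trans h1)) (Subtype.ext ((hg _).trans h2))
  · intro hind
    have hmemf {v} : v ∈ M ⊓ LinearMap.ker f ↔ v ∈ M ∧ det2 v W = 0 := by
      rw [Submodule.mem_inf, LinearMap.mem_ker, hf]
    have hmemg {v} : v ∈ M ⊓ LinearMap.ker g ↔ v ∈ M ∧ det2 U v = 0 := by
      rw [Submodule.mem_inf, LinearMap.mem_ker, hg]
    have hsup : M ⊓ LinearMap.ker g ⊔ M ⊓ LinearMap.ker f = M := by
      refine le_antisymm (sup_le inf_le_left inf_le_left) fun v hv => ?_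
      obtain ⟨hvJ, hvK⟩ := (hM v).mp hv
      obtain ⟨h1, h2⟩ := hcomb (det2 v W) 0
      obtain ⟨h3, h4⟩ := hcomb 0 (det2 U v)
      refine Submodule.mem_sup.mpr
        ⟨_, hmemg.mpr ⟨(hM _).mpr ⟨h1.symm ▸ hvJ, h2.symm ▸ K.zero_mem⟩, h2⟩,
        _, hmemf.mpr ⟨(hM _).mpr ⟨h3.symm ▸ J.zero_mem, h4.symm ▸ hvK⟩, h3⟩, ?_⟩
      conv_rhs => rw [hrec v]
      simp
    have hinf : M ⊓ LinearMap.ker g ⊓ (M ⊓ LinearMap.ker f) = ⊥ := by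
      rw [eq_bot_iff]
      intro v hv
      have h1 := (hmemg.mp hv.1).2
      have h2 := (hmemf.mp hv.2).2
      rw [Submodule.mem_bot, hrec v, h1, h2]
      simp
    rcases hind (M ⊓ LinearMap.ker g) (M ⊓ LinearMap.ker f) hsup hinf with h | h
    · obtain ⟨a, ha, ha0⟩ := Submodule.exists_mem_ne_zero_of_ne_bot hJ
      obtain ⟨h1, h2⟩ := hcomb a 0
      have hv := hmemg.mpr ⟨(hM _).mpr ⟨h1.symm ▸ ha, h2.symm ▸ K.zero_mem⟩, h2⟩
      rw [h, Submodule.mem_bot] at hv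
      rw [hv] at h1
      exact ha0 (by simpa [det2] using h1.symm)
    · obtain ⟨b, hb, hb0⟩ := Submodule.exists_mem_ne_zero_of_ne_bot hK
      obtain ⟨h1, h2⟩ := hcomb 0 b
      have hv := hmemf.mpr ⟨(hM _).mpr ⟨h1.symm ▸ J.zero_mem, h2.symm ▸ hb⟩, h1⟩
      rw [h, Submodule.mem_bot] at hv
      rw [hv] at h2
      exact hb0 (by simpa [det2] using h2.symm)

theorem stmt15 [IsNoetherianRing R] [IsLocalRing R] [IsDomain R]
    [Infinite (ResidueField R)]
    (hdim : ringKrullDim R = 2)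
    (x y : R) (hmax : maximalIdeal R = Ideal.span {x, y})
    (m n : ℕ) (hm : 2 ≤ m) (hn : 2 ≤ n)
    (M : Submodule R (Fin 2 → R)) (hfg : M.FG)
    (hrk : minorsIdeal M ≠ ⊥) (hic : IsIntClMod M)
    (hnofree : ¬ HasFreeSummand M)
    (hIM : minorsIdeal M = Ideal.span {x ^ m, x * y, y ^ n}) :
    Nonempty (M ≃ₗ[R]
        (↥(Ideal.span {x, y ^ (n - 1)}) × ↥(Ideal.span {x ^ (m - 1), y}))) ∧
      ¬ IsIndecomposable M := by
  have hmax' : maximalIdeal R = Ideal.span {y, x} := by rw [hmax, Set.pair_comm]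
  have hregx : ∀ t, y ∣ x * t → y ∣ t := fun _ =>
    dvd_of_dvd_mul_of_ringKrullDim_eq_two hdim hmax
  have hregy : ∀ t, x ∣ y * t → x ∣ t := fun _ =>
    dvd_of_dvd_mul_of_ringKrullDim_eq_two hdim hmax'
  obtain ⟨m, rfl⟩ := Nat.exists_eq_add_of_le' hm
  obtain ⟨n, rfl⟩ := Nat.exists_eq_add_of_le' hn
  have hdet {v w : Fin 2 → R} (hv : v ∈ M) (hw : w ∈ M) :
      det2 v w ∈ Ideal.span {x ^ (m + 2), x * y, y ^ (n + 2)} :=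
    hIM ▸ Ideal.subset_span ⟨v, hv, w, hw, rfl⟩
  have hdecomp {v : Fin 2 → R} (hv : v ∈ M) : ∃ v₁ v₂ : Fin 2 → R, v = x • v₁ + y • v₂ := by
    have h i : ∃ a b, a * x + b * y = v i := Ideal.mem_span_pair.mp
      (hmax ▸ apply_mem_maximalIdeal_of_not_hasFreeSummand hnofree hv i)
    choose a b hab using h
    refine ⟨a, b, funext fun i => ?_⟩
    simp [← hab, mul_comm]
  obtain ⟨U, U', W', W, hU, hW, hUW⟩ : ∃ U U' W' W : Fin 2 → R,
      x • U + y • U' ∈ M ∧ x • W' + y • W ∈ M ∧ IsUnit (det2 U W) := by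
    by_contra! hcon
    refine mul_notMem_span_sq_pair hdim hmax ?_
    have hle : minorsIdeal M ≤ Ideal.span {x ^ 2, y ^ 2} := by
      refine Ideal.span_le.mpr ?_
      rintro _ ⟨v, hv, w, hw, rfl⟩
      obtain ⟨v₁, v₂, rfl⟩ := hdecomp hv
      obtain ⟨w₁, w₂, rfl⟩ := hdecomp hw
      obtain ⟨a, b, hab⟩ := Ideal.mem_span_pair.mp
        (hmax ▸ (mem_maximalIdeal _).mpr (hcon v₁ v₂ w₁ w₂ hv hw))
      obtain ⟨a', b', hab'⟩ := Ideal.mem_span_pair.mp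
        (hmax ▸ (mem_maximalIdeal _).mpr (hcon w₁ w₂ v₁ v₂ hw hv))
      refine Ideal.mem_span_pair.mpr ⟨det2 v₁ w₁ + y * (a - a'), det2 v₂ w₂ + x * (b - b'), ?_⟩
      simp only [det2, Pi.add_apply, Pi.smul_apply, smul_eq_mul] at hab hab' ⊢
      linear_combination x * y * hab - x * y * hab'
    exact hle (hIM ▸ Ideal.subset_span (by simp))
  have hleK : Ideal.span {x ^ (m + 2), x * y, y ^ (n + 2)} ≤ Ideal.span {x ^ (m + 2), y} := by
    rw [Ideal.span_le]
    rintro _ (rfl | rfl | rfl)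
    · exact Ideal.subset_span (by simp)
    · exact Ideal.mul_mem_left _ _ (Ideal.subset_span (by simp))
    · exact Ideal.pow_mem_of_mem _ (Ideal.subset_span (by simp)) _ (by omega)
  have hleJ : Ideal.span {x ^ (m + 2), x * y, y ^ (n + 2)} ≤ Ideal.span {y ^ (n + 2), x} := by
    rw [Ideal.span_le]
    rintro _ (rfl | rfl | rfl)
    · exact Ideal.pow_mem_of_mem _ (Ideal.subset_span (by simp)) _ (by omega)
    · exact Ideal.mul_mem_right _ _ (Ideal.subset_span (by simp))
    · exact Ideal.subset_span (by simp)
  have hmulle : Ideal.span {x, y ^ (n + 1)} * Ideal.span {x ^ (m + 1), y} ≤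
      Ideal.span {x ^ (m + 2), x * y, y ^ (n + 2)} := by
    rw [Ideal.span_mul_span', Ideal.span_le]
    rintro _ ⟨_, rfl | rfl, _, rfl | rfl, rfl⟩
    · exact Ideal.subset_span (Or.inl (by ring))
    · exact Ideal.subset_span (Or.inr (Or.inl rfl))
    · have : y ^ (n + 1) * x ^ (m + 1) = x ^ m * y ^ n * (x * y) := by ring
      simp only [this]
      exact Ideal.mul_mem_left _ _ (Ideal.subset_span (by simp))
    · exact Ideal.subset_span (Or.inr (Or.inr (by simp; ring)))
  have hsub {v : Fin 2 → R} (hv : v ∈ M) :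
      det2 v W ∈ Ideal.span {x, y ^ (n + 1)} ∧ det2 U v ∈ Ideal.span {x ^ (m + 1), y} := by
    constructor
    · rw [Set.pair_comm]
      refine mem_span_pow_pair_of_mul_mem hregy (n + 1) ?_
      have h1 := sub_mem (hleJ (hdet hv hW))
        (Ideal.mul_mem_left _ (det2 v W') (Ideal.subset_span (by simp : x ∈ {y ^ (n + 2), x})))
      convert h1 using 1
      simp [det2]
      ring
    · refine mem_span_pow_pair_of_mul_mem hregx (m + 1) ?_
      have h1 := sub_mem (hleK (hdet hU hv))
        (Ideal.mul_mem_left _ (det2 U' v) (Ideal.subset_span (by simp : y ∈ {x ^ (m + 2), y})))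
      convert h1 using 1
      simp [det2]
      ring
  have hx0 : x ≠ 0 := fun h => mul_notMem_span_sq_pair hdim hmax (by simp [h])
  have hy0 : y ≠ 0 := fun h => mul_notMem_span_sq_pair hdim hmax (by simp [h])
  refine equiv_prod_and_not_isIndecomposable (U := U) (W := W)
    (fun h => hx0 ?_) (fun h => hy0 ?_) hUW fun v => ⟨hsub, fun hv => ?_⟩
  · exact (Submodule.mem_bot R).mp (h ▸ Ideal.subset_span (by simp))
  · exact (Submodule.mem_bot R).mp (h ▸ Ideal.subset_span (by simp))
  · refine hic.mem_of_det2_mem fun w hw => ?_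
    obtain ⟨hwJ, hwK⟩ := hsub hw
    rw [hIM]
    refine (Ideal.unit_mul_mem_iff_mem _ hUW).mp ?_
    have h1 := sub_mem (hmulle (Ideal.mul_mem_mul hv.1 hwK))
      (hmulle (Ideal.mul_mem_mul hwJ hv.2))
    convert h1 using 1
    simp only [det2]
    ring
end
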